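/- arXiv:1901.07231 — 8 statements merged into one kernel-verified Lean document; each statement's English description precedes it below -/
import Mathlib

section
/- Let x ∈ ℝ^m with x ≥ 0 componentwise such that {f ∈ ℝ^m : Af = b and f_e = 0 whenever x_e = 0} is nonempty, and let q be the minimum energy solution with respect to x. Then |q_e| ≤ D·‖b‖₁ for every e ∈ [m], where ‖b‖₁ = ∑_i |b_i|. -/
open Matrix Filter Set

/-- Energy of `f` with respect to costs `c` and (positive) capacities `x`:
`E_x(f) = ∑_e (c_e/x_e) f_e²`. -/
noncomputable def energy {m : ℕ} (c x f : Fin m → ℝ) : ℝ :=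
  ∑ e, c e / x e * f e ^ 2

/-- Energy restricted to the support of `x` (for `x ≥ 0` possibly with zeros):
`∑_{e : x_e ≠ 0} (c_e/x_e) f_e²`. -/
noncomputable def energyS {m : ℕ} (c x f : Fin m → ℝ) : ℝ :=
  ∑ e, if x e = 0 then 0 else c e / x e * f e ^ 2

/-- Cost of a vector: `cᵀ|f| = ∑_e c_e |f_e|`. -/
noncomputable def costVec {m : ℕ} (c f : Fin m → ℝ) : ℝ := ∑ e, c e * |f e|

/-- `f'` is sign-compatible with `f`: `f'_e ≠ 0` implies `f'_e f_e > 0`. -/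
def SignCompat {m : ℕ} (f' f : Fin m → ℝ) : Prop :=
  ∀ e, f' e ≠ 0 → 0 < f' e * f e

/-- `f` is a basic feasible solution of `A f = b`: there is an injective choice `B`
of `n` columns such that `A_B` is invertible, `f_B = A_B⁻¹ b`, and `f` vanishes
outside `B`. -/
noncomputable def IsBFS {n m : ℕ} (A : Matrix (Fin n) (Fin m) ℝ) (b : Fin n → ℝ)
    (f : Fin m → ℝ) : Prop :=
  A.mulVec f = b ∧ ∃ B : Fin n → Fin m, Function.Injective B ∧
    IsUnit (A.submatrix id B).det ∧
    (∀ i, f (B i) = (A.submatrix id B)⁻¹.mulVec b i) ∧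
    ∀ e, (∀ i, B i ≠ e) → f e = 0

/-- The set of absolute values of determinants of square submatrices of `A`. -/
def subdetSet {n m : ℕ} (A : Matrix (Fin n) (Fin m) ℝ) : Set ℝ :=
  {d | ∃ (k : ℕ) (r : Fin k → Fin n) (s : Fin k → Fin m),
    Function.Injective r ∧ Function.Injective s ∧ d = |(A.submatrix r s).det|}

theorem aux_step {m : ℕ} (f g : Fin m → ℝ) (hs : ∀ e, f e = 0 → g e = 0)
    (hneg : ∃ e, g e * f e < 0) :
    ∃ t : ℝ, 0 < t ∧ SignCompat (fun e => f e + t * g e) f ∧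
      ∃ e, f e ≠ 0 ∧ f e + t * g e = 0 := by
  classical
  obtain ⟨e₁, he₁⟩ := hneg
  obtain ⟨e₀, he₀, hmin⟩ := Finset.exists_min_image
    (Finset.univ.filter (fun e => g e * f e < 0)) (fun e => - f e / g e) ⟨e₁, by simpa using he₁⟩
  simp only [Finset.mem_filter, Finset.mem_univ, true_and] at he₀ hmin
  have hg0 : g e₀ ≠ 0 := by rintro h; simp [h] at he₀
  have hf0 : f e₀ ≠ 0 := by rintro h; simp [h] at he₀
  have key : ∀ e, g e ≠ 0 → - f e / g e = -(g e * f e) / (g e)^2 := by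
    intro e he; field_simp
  have ht : 0 < - f e₀ / g e₀ := by
    rw [key _ hg0]; apply div_pos (by linarith) (by positivity)
  refine ⟨- f e₀ / g e₀, ht, ?_, e₀, hf0, by field_simp; ring⟩
  intro e he
  simp only at he ⊢
  have hfe : f e ≠ 0 := by
    intro h; apply he; simp [h, hs e h]
  have h1 : 0 ≤ (f e + - f e₀ / g e₀ * g e) * f e := by
    by_cases hn : g e * f e < 0
    · have h2 := hmin e hn
      have hge : g e ≠ 0 := by rintro h; simp [h] at hn
      have h3 := mul_le_mul_of_nonneg_right h2 (by linarith : 0 ≤ -(g e * f e))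
      have h4 : - f e / g e * -(g e * f e) = f e ^ 2 := by field_simp
      nlinarith
    · have := mul_nonneg ht.le (not_lt.mp hn)
      nlinarith [sq_nonneg (f e)]
  exact lt_of_le_of_ne h1 (Ne.symm (mul_ne_zero he hfe))

theorem aux_int_det {k : ℕ} (M : Matrix (Fin k) (Fin k) ℝ)
    (hZ : ∀ i j, ∃ z : ℤ, M i j = (z : ℝ)) (h0 : M.det ≠ 0) : 1 ≤ |M.det| := by
  choose z hz using hZ
  have : M = (Matrix.of z).map (Int.castRingHom ℝ) := by
    ext i j; simp [hz]
  have h2 : M.det = (((Matrix.of z).det : ℤ) : ℝ) := by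
    rw [this, ← RingHom.mapMatrix_apply, ← RingHom.map_det]; simp
  rw [h2] at h0 ⊢
  have h3 : (Matrix.of z).det ≠ 0 := by exact_mod_cast h0
  exact_mod_cast Int.one_le_abs h3

theorem aux_rows {n k : ℕ} (M : Matrix (Fin n) (Fin k) ℝ)
    (h : LinearIndependent ℝ M.col) :
    ∃ r : Fin k → Fin n, Function.Injective r ∧ (M.submatrix r id).det ≠ 0 := by
  have hr : M.rank = k := by
    rw [← Matrix.rank_transpose, LinearIndependent.rank_matrix (M := Mᵀ) h]; simp
  rw [Matrix.rank_eq_finrank_span_row] at hr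
  obtain ⟨F, hF, -, hli⟩ := Submodule.exists_fun_fin_finrank_span_eq ℝ (Set.range M.row)
  choose r hr' using hF
  have hFr : F = M.row ∘ r := by ext i : 1; exact (hr' i).symm
  refine ⟨r ∘ Fin.cast hr.symm, ?_, ?_⟩
  · refine Function.Injective.comp ?_ (Fin.cast_injective _)
    intro a c hac
    apply hli.injective
    rw [hFr]; simp [hac]
  · have h2 : LinearIndependent ℝ (M.submatrix (r ∘ Fin.cast hr.symm) id).row := by
      have := hli.comp (Fin.cast hr.symm) (Fin.cast_injective _)
      rw [hFr] at this
      exact this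
    rw [Matrix.linearIndependent_rows_iff_isUnit, Matrix.isUnit_iff_isUnit_det] at h2
    exact h2.ne_zero

theorem aux_base {n k : ℕ} (M : Matrix (Fin n) (Fin k) ℝ) (b : Fin n → ℝ)
    (hZ : ∀ i j, ∃ z : ℤ, M i j = (z : ℝ)) (D : ℝ)
    (hD : ∀ d ∈ subdetSet M, d ≤ D)
    (h : LinearIndependent ℝ M.col) (y : Fin k → ℝ) (hy : M.mulVec y = b) (j : Fin k) :
    |y j| ≤ D * ∑ i, |b i| := by
  obtain ⟨r, hr, hdet⟩ := aux_rows M h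
  obtain _ | k := k
  · exact j.elim0
  set N := M.submatrix r id with hN
  have hNy : N.mulVec y = fun i => b (r i) := by
    ext i; rw [← hy]; rfl
  have h1 : 1 ≤ |N.det| := aux_int_det N (fun i j => hZ _ _) hdet
  have h2 : N.det * y j = ∑ i, N.adjugate j i * b (r i) := by
    have := congrArg (fun v => N.adjugate.mulVec v j) hNy
    simp only [Matrix.mulVec_mulVec, Matrix.adjugate_mul, Matrix.smul_mulVec, Matrix.one_mulVec] at this
    simpa [Matrix.mulVec, dotProduct] using this
  have hadj : ∀ i, |N.adjugate j i| ≤ D := by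
    intro i
    rw [Matrix.adjugate_fin_succ_eq_det_submatrix, abs_mul, abs_pow, abs_neg, abs_one, one_pow, one_mul]
    apply hD
    exact ⟨k, r ∘ i.succAbove, j.succAbove, hr.comp Fin.succAbove_right_injective,
      Fin.succAbove_right_injective, rfl⟩
  have hD0 : 0 ≤ D := (abs_nonneg _).trans (hadj j)
  calc |y j| ≤ |N.det| * |y j| := le_mul_of_one_le_left (abs_nonneg _) h1
    _ = |∑ i, N.adjugate j i * b (r i)| := by rw [← abs_mul, h2]
    _ ≤ ∑ i, |N.adjugate j i * b (r i)| := Finset.abs_sum_le_sum_abs _ _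
    _ ≤ ∑ i, D * |b (r i)| := by
        apply Finset.sum_le_sum; intro i _
        rw [abs_mul]; exact mul_le_mul_of_nonneg_right (hadj i) (abs_nonneg _)
    _ = D * ∑ i, |b (r i)| := by rw [Finset.mul_sum]
    _ ≤ D * ∑ i, |b i| := by
        apply mul_le_mul_of_nonneg_left _ hD0
        rw [← Finset.sum_image (s := Finset.univ) (g := r) (f := fun i => |b i|) (fun _ _ _ _ h => hr h)]
        exact Finset.sum_le_sum_of_subset_of_nonneg (Finset.subset_univ _) (fun _ _ _ => abs_nonneg _)

theorem aux_main {n m : ℕ} (A : Matrix (Fin n) (Fin m) ℝ) (b : Fin n → ℝ)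
    (hAZ : ∀ i j, ∃ z : ℤ, A i j = (z : ℝ)) (D : ℝ)
    (hD : ∀ d ∈ subdetSet A, d ≤ D) (N : ℕ) :
    ∀ f : Fin m → ℝ, (Finset.univ.filter (fun e => f e ≠ 0)).card ≤ N → A.mulVec f = b →
      (∀ g, A.mulVec g = 0 → SignCompat g f → g = 0) → ∀ e, |f e| ≤ D * ∑ i, |b i| := by
  induction N with
  | zero =>
    intro f hf _ _ e
    have hD0 : 0 ≤ D := (abs_nonneg _).trans (hD _ ⟨0, Fin.elim0, Fin.elim0,
      fun a => a.elim0, fun a => a.elim0, rfl⟩)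
    have : f e = 0 := by
      by_contra h
      have : e ∈ Finset.univ.filter (fun e => f e ≠ 0) := by simpa using h
      simp only [Nat.le_zero, Finset.card_eq_zero] at hf
      rw [hf] at this; simp at this
    rw [this, abs_zero]; positivity
  | succ N ih =>
    intro f hf hAf hno e
    by_cases hdep : ∃ g : Fin m → ℝ, g ≠ 0 ∧ A.mulVec g = 0 ∧ ∀ e, f e = 0 → g e = 0
    · obtain ⟨g, hg0, hAg, hgs⟩ := hdep
      have hneg : ∀ g : Fin m → ℝ, g ≠ 0 → A.mulVec g = 0 → (∀ e, f e = 0 → g e = 0) →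
          ∃ t : ℝ, 0 < t ∧ ∀ e, |f e + t * g e| ≤ D * ∑ i, |b i| := by
        intro g hg0 hAg hgs
        have h1 : ∃ e, g e * f e < 0 := by
          by_contra! hcon
          apply hg0
          apply hno g hAg
          intro e he
          exact lt_of_le_of_ne (hcon e) (Ne.symm (mul_ne_zero he (fun h => he (hgs e h))))
        obtain ⟨t, ht, hsc, e₀, hfe₀, hz⟩ := aux_step f g hgs h1
        refine ⟨t, ht, ih (fun e => f e + t * g e) ?_ ?_ ?_⟩
        · have : (Finset.univ.filter (fun e => f e + t * g e ≠ 0)) ⊂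
              Finset.univ.filter (fun e => f e ≠ 0) := by
            rw [Finset.ssubset_iff_of_subset]
            · exact ⟨e₀, by simpa using hfe₀, by simpa using hz⟩
            · intro e
              simp only [Finset.mem_filter, Finset.mem_univ, true_and]
              intro h h'
              exact h (by simp [h', hgs e h'])
          have := Finset.card_lt_card this
          omega
        · have : (fun e => f e + t * g e) = f + t • g := by ext; simp
          rw [this, Matrix.mulVec_add, Matrix.mulVec_smul, hAg, hAf]; simp
        · intro g' hAg' hsc'
          apply hno g' hAg'
          intro e he
          have h2 := hsc' e he
          have h3 := hsc e (fun h => by simp only at h h2; rw [h] at h2; simp at h2)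
          simp only at h2 h3
          set u := f e + t * g e
          have h4 : 0 < (g' e * f e) * u ^ 2 := by
            have := mul_pos h2 h3; nlinarith
          exact pos_of_mul_pos_left h4 (sq_nonneg _)
      obtain ⟨t, ht, h1⟩ := hneg g hg0 hAg hgs
      obtain ⟨s, hs, h2⟩ := hneg (-g) (neg_ne_zero.mpr hg0) (by rw [Matrix.mulVec_neg, hAg, neg_zero])
        (fun e he => by simp [hgs e he])
      have a1 := abs_le.mp (h1 e)
      have a2 := abs_le.mp (h2 e)
      simp only [Pi.neg_apply] at a2
      set K := D * ∑ i, |b i|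
      rw [abs_le]
      constructor
      · have := mul_le_mul_of_nonneg_left a1.1 hs.le
        have := mul_le_mul_of_nonneg_left a2.1 ht.le
        by_contra! hc
        nlinarith
      · have := mul_le_mul_of_nonneg_left a1.2 hs.le
        have := mul_le_mul_of_nonneg_left a2.2 ht.le
        by_contra! hc
        nlinarith
    · push Not at hdep
      by_cases hfe : f e = 0
      · have hD0 : 0 ≤ D := (abs_nonneg _).trans (hD _ ⟨0, Fin.elim0, Fin.elim0,
          fun a => a.elim0, fun a => a.elim0, rfl⟩)
        rw [hfe, abs_zero]; positivity
      set S := Finset.univ.filter (fun e => f e ≠ 0) with hS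
      let σ : Fin S.card ≃ S := S.equivFin.symm
      let s : Fin S.card → Fin m := fun i => (σ i : Fin m)
      have hs : Function.Injective s := fun a b h => σ.injective (Subtype.ext h)
      have hsr : ∀ e, f e ≠ 0 → ∃ i, s i = e := by
        intro e he
        exact ⟨σ.symm ⟨e, by simpa [hS] using he⟩, by simp [s]⟩
      have hext : ∀ g : Fin m → ℝ, (∀ e, f e = 0 → g e = 0) →
          (A.submatrix id s).mulVec (g ∘ s) = A.mulVec g := by
        intro g hg
        ext i
        simp only [Matrix.mulVec, dotProduct, Matrix.submatrix_apply, id, Function.comp]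
        apply Finset.sum_of_injOn s hs.injOn (by simp)
        · intro e _ he
          have : f e = 0 := by
            by_contra h
            obtain ⟨i, hi⟩ := hsr e h
            exact he ⟨i, by simp, hi⟩
          simp [hg e this]
        · simp
      obtain ⟨j, hj⟩ := hsr e hfe
      rw [← hj]
      refine aux_base (A.submatrix id s) b (fun i j => hAZ _ _) D ?_ ?_ (f ∘ s) ?_ j
      · rintro d ⟨k, r, s', hr, hs', rfl⟩
        exact hD _ ⟨k, r, s ∘ s', hr, hs.comp hs', rfl⟩
      · rw [← Matrix.mulVec_injective_iff, ← Matrix.coe_mulVecLin, ← LinearMap.ker_eq_bot, LinearMap.ker_eq_bot']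
        intro y hy
        by_contra hy0
        let g : Fin m → ℝ := Function.extend s y 0
        have hgs : g ∘ s = y := by
          ext i; exact hs.extend_apply y 0 i
        have hg1 : ∀ e, f e = 0 → g e = 0 := by
          intro e he
          have : ¬ ∃ i, s i = e := by
            rintro ⟨i, rfl⟩
            have := (σ i).2
            exact (Finset.mem_filter.mp this).2 he
          simp [g, Function.extend_apply' _ _ _ this]
        obtain ⟨e', h1, h2⟩ := hdep g (fun h => hy0 (by rw [← hgs, h]; rfl))
          (by rw [← hext g hg1, hgs]; simpa using hy)
        exact h2 (hg1 e' h1)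
      · rw [hext f (fun _ h => h), hAf]

/-- For `x ≥ 0`, the minimum energy solution `q` with respect to `x`
satisfies `|q_e| ≤ D‖b‖₁` for every `e`, where `D` is the maximum absolute value of
the determinant of a square submatrix of `A`. -/
theorem min_energy_solution_bounded {n m : ℕ} (hnm : n ≤ m)
    (A : Matrix (Fin n) (Fin m) ℝ) (b : Fin n → ℝ) (c : Fin m → ℝ)
    (hAZ : ∀ i j, ∃ z : ℤ, A i j = (z : ℝ))
    (hbZ : ∀ i, ∃ z : ℤ, b i = (z : ℝ))
    (hcZ : ∀ e, ∃ z : ℤ, c e = (z : ℝ))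
    (hc1 : ∀ e, 1 ≤ c e)
    (hrank : A.rank = n)
    (hfeas : ∃ f : Fin m → ℝ, A.mulVec f = b)
    (D : ℝ) (hD : IsGreatest (subdetSet A) D)
    (x : Fin m → ℝ) (hx : ∀ e, 0 ≤ x e)
    (q : Fin m → ℝ)
    (hqfeas : A.mulVec q = b ∧ ∀ e, x e = 0 → q e = 0)
    (hqmin : ∀ f : Fin m → ℝ, A.mulVec f = b → (∀ e, x e = 0 → f e = 0) →
      energyS c x q ≤ energyS c x f) :
    ∀ e, |q e| ≤ D * ∑ i, |b i| := by
  intro e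
  refine aux_main A b hAZ D hD.2 _ q le_rfl hqfeas.1 ?_ e
  intro g hAg hsc
  by_contra hg0
  have hgx : ∀ e, x e = 0 → g e = 0 := by
    intro e he
    by_contra h
    have := hsc e h
    rw [hqfeas.2 e he] at this; simp at this
  let w : Fin m → ℝ := fun e => if x e = 0 then 0 else c e / x e
  have hw : ∀ f, energyS c x f = ∑ e, w e * f e ^ 2 := by
    intro f; unfold energyS
    apply Finset.sum_congr rfl; intro e _
    simp only [w]; split_ifs <;> simp
  have hw0 : ∀ e, 0 ≤ w e := by
    intro e; simp only [w]; split_ifs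
    · exact le_rfl
    · exact div_nonneg (by linarith [hc1 e]) (hx e)
  obtain ⟨e₀, he₀⟩ := Function.ne_iff.mp hg0
  simp only [Pi.zero_apply] at he₀
  have hwe₀ : 0 < w e₀ := by
    have hxe : x e₀ ≠ 0 := fun h => he₀ (hgx _ h)
    simp only [w, if_neg hxe]
    exact div_pos (by linarith [hc1 e₀]) (lt_of_le_of_ne (hx e₀) (Ne.symm hxe))
  have hP : 0 < ∑ e, w e * (g e * q e) := by
    apply Finset.sum_pos'
    · intro e _
      apply mul_nonneg (hw0 e)
      by_cases h : g e = 0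
      · simp [h]
      · exact (hsc e h).le
    · exact ⟨e₀, Finset.mem_univ _, mul_pos hwe₀ (hsc _ he₀)⟩
  have hG : 0 < ∑ e, w e * g e ^ 2 := by
    apply Finset.sum_pos'
    · intro e _
      exact mul_nonneg (hw0 e) (sq_nonneg _)
    · exact ⟨e₀, Finset.mem_univ _, by positivity⟩
  set P := ∑ e, w e * (g e * q e) with hPd
  set G := ∑ e, w e * g e ^ 2 with hGd
  have hm := hqmin (q - (P / G) • g)
    (by rw [Matrix.mulVec_sub, Matrix.mulVec_smul, hAg, hqfeas.1]; simp)
    (fun e he => by simp [hgx e he, hqfeas.2 e he])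
  rw [hw, hw] at hm
  have hexp : ∑ e, w e * (q - (P / G) • g) e ^ 2
      = ∑ e, w e * q e ^ 2 - 2 * (P / G) * P + (P / G) ^ 2 * G := by
    conv_rhs => rw [hPd, hGd, Finset.mul_sum, Finset.mul_sum, ← Finset.sum_sub_distrib, ← Finset.sum_add_distrib]
    apply Finset.sum_congr rfl; intro e _
    simp only [Pi.sub_apply, Pi.smul_apply, smul_eq_mul]
    ring
  rw [hexp] at hm
  have h1 : (P / G) ^ 2 * G = P / G * P := by field_simp
  have h2 : 0 < P / G * P := by positivity
  nlinarith
end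

section
/- Let f be a basic feasible solution of Af = b and let x = |f| (componentwise absolute value). Then the minimum energy solution q with respect to x satisfies |q_e| = x_e for every e; in particular, x is a fixed point of the Physarum dynamics. -/
open Matrix Filter Set

/-- If `f` is a basic feasible solution and `x = |f|`, then the
minimum energy solution `q` with respect to `x` satisfies `|q_e| = x_e` for all `e`;
in particular `x` is a fixed point of the Physarum dynamics. -/
theorem bfs_abs_is_fixed_point {n m : ℕ} (hnm : n ≤ m)
    (A : Matrix (Fin n) (Fin m) ℝ) (b : Fin n → ℝ) (c : Fin m → ℝ)
    (hAZ : ∀ i j, ∃ z : ℤ, A i j = (z : ℝ))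
    (hbZ : ∀ i, ∃ z : ℤ, b i = (z : ℝ))
    (hcZ : ∀ e, ∃ z : ℤ, c e = (z : ℝ))
    (hc1 : ∀ e, 1 ≤ c e)
    (hrank : A.rank = n)
    (f : Fin m → ℝ) (hf : IsBFS A b f)
    (x : Fin m → ℝ) (hx : ∀ e, x e = |f e|)
    (q : Fin m → ℝ)
    (hqfeas : A.mulVec q = b ∧ ∀ e, x e = 0 → q e = 0)
    (hqmin : ∀ g : Fin m → ℝ, A.mulVec g = b → (∀ e, x e = 0 → g e = 0) →
      energyS c x q ≤ energyS c x g) :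
    ∀ e, |q e| = x e := by
  obtain ⟨-, B, hB, hdet, hfB, hf0⟩ := hf
  obtain ⟨hq, hq0⟩ := hqfeas
  have hq0' : ∀ e, (∀ i, B i ≠ e) → q e = 0 := fun e he =>
    hq0 e (by rw [hx, hf0 e he, abs_zero])
  have key : (A.submatrix id B).mulVec (fun i => q (B i)) = b := by
    rw [← hq]
    funext i
    simp only [Matrix.mulVec, dotProduct, Matrix.submatrix_apply, id]
    refine Fintype.sum_of_injective B hB _ _ ?_ (fun _ => rfl)
    intro e he
    rw [hq0' e (fun i h => he ⟨i, h⟩), mul_zero]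
  have hqB : ∀ i, q (B i) = f (B i) := by
    intro i
    rw [hfB, ← key, Matrix.mulVec_mulVec, Matrix.nonsing_inv_mul _ hdet, Matrix.one_mulVec]
  intro e
  rw [hx]
  by_cases he : ∃ i, B i = e
  · obtain ⟨i, rfl⟩ := he
    rw [hqB]
  · have he' : ∀ i, B i ≠ e := fun i h => he ⟨i, h⟩
    rw [hq0' e he', hf0 e he']
end

section
/- Assume that any two distinct basic feasible solutions of Af = b have distinct cost cᵀ|f|. Let x ∈ ℝ^m with x ≥ 0 be such that the minimum energy solution q with respect to x exists and satisfies |q_e| = x_e for every e. Then x = |f| for some basic feasible solution f of Af = b. -/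
open Matrix Filter Set

theorem aux_bfs_or_ker {n m : ℕ} (A : Matrix (Fin n) (Fin m) ℝ) (b : Fin n → ℝ)
    (hrank : A.rank = n) (g : Fin m → ℝ) (hg : A.mulVec g = b) :
    IsBFS A b g ∨ ∃ h : Fin m → ℝ, A.mulVec h = 0 ∧ h ≠ 0 ∧ ∀ e, g e = 0 → h e = 0 := by
  classical
  by_cases hli : LinearIndepOn ℝ A.col {e | g e ≠ 0}
  · left
    obtain ⟨s, -, hgs, hspan, hs⟩ := exists_linearIndepOn_extension hli (Set.subset_univ _)
    have htop : Submodule.span ℝ (Set.range A.col) = ⊤ := by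
      apply Submodule.eq_top_of_finrank_eq
      rw [← Matrix.rank_eq_finrank_span_cols, hrank]
      simp
    have hcard : Fintype.card s = n := by
      have h1 : Submodule.span ℝ (Set.range (fun i : s => A.col i)) = ⊤ := by
        rw [eq_top_iff, ← htop, Submodule.span_le]
        convert hspan using 1
        · simp
        · ext; simp [Set.image_eq_range]
      have := finrank_span_eq_card (R := ℝ) (b := fun i : s => A.col i) hs
      rw [h1] at this
      simpa using this.symm
    let E : Fin n ≃ s := (Fintype.equivFinOfCardEq hcard).symm
    let B : Fin n → Fin m := fun i => E i
    have hB : Function.Injective B := Subtype.val_injective.comp E.injective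
    have hunit : IsUnit (A.submatrix id B) := by
      rw [← Matrix.linearIndependent_cols_iff_isUnit]
      exact LinearIndependent.comp hs E E.injective
    have hoff : ∀ e, (∀ i, B i ≠ e) → g e = 0 := by
      intro e he
      by_contra hne
      have : e ∈ s := hgs hne
      exact he (E.symm ⟨e, this⟩) (by simp [B])
    have hdet := (Matrix.isUnit_iff_isUnit_det _).1 hunit
    have hmul : (A.submatrix id B).mulVec (fun i => g (B i)) = b := by
      rw [← hg]
      ext r
      simp only [Matrix.mulVec, dotProduct, Matrix.submatrix_apply, id]
      rw [← Finset.sum_image (s := Finset.univ) (g := B) (f := fun e => A r e * g e)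
        (fun a _ b _ h => hB h)]
      apply Finset.sum_subset (Finset.subset_univ _)
      intro e _ he
      rw [hoff e, mul_zero]
      intro i hi
      exact he (Finset.mem_image.2 ⟨i, Finset.mem_univ _, hi⟩)
    refine ⟨hg, B, hB, hdet, ?_, hoff⟩
    intro i
    rw [← hmul, Matrix.mulVec_mulVec, Matrix.nonsing_inv_mul _ hdet, Matrix.one_mulVec]
  · right
    obtain ⟨f, hf, hf0, hne⟩ := linearDepOn_iff'.1 hli
    refine ⟨f, ?_, ?_, ?_⟩
    · rw [← hf0, Finsupp.linearCombination_apply, Finsupp.sum_fintype _ _ (by simp)]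
      ext r
      simp [Matrix.mulVec, dotProduct, mul_comm]
    · intro h; exact hne (DFunLike.coe_injective h)
    · intro e he
      by_contra hne
      exact (Finsupp.mem_supported _ _).1 hf (Finsupp.mem_support_iff.2 hne) he

theorem aux_move {m : ℕ} (g h : Fin m → ℝ) (hsupp : ∀ e, g e = 0 → h e = 0)
    (hneg : ∃ e, g e * h e < 0) :
    ∃ t : ℝ, 0 < t ∧ SignCompat (g + t • h) g ∧ ∃ e, g e ≠ 0 ∧ g e + t * h e = 0 := by
  classical
  obtain ⟨e0, he0⟩ := hneg
  obtain ⟨e, he, hmin⟩ := Finset.exists_min_image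
    (Finset.univ.filter fun e => g e * h e < 0) (fun e => -(g e / h e)) ⟨e0, by simpa using he0⟩
  simp only [Finset.mem_filter, Finset.mem_univ, true_and] at he hmin
  have hh : h e ≠ 0 := by rintro h0; simp [h0] at he
  have hgne : g e ≠ 0 := by rintro h0; simp [h0] at he
  have key : ∀ e, g e * h e < 0 → -(g e / h e) = g e ^ 2 / (-(g e * h e)) := by
    intro e he
    have hh : h e ≠ 0 := by rintro h0; simp [h0] at he
    have hgne : g e ≠ 0 := by rintro h0; simp [h0] at he
    field_simp
  have ht : 0 < -(g e / h e) := by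
    rw [key e he]; exact div_pos (by positivity) (by linarith)
  refine ⟨-(g e / h e), ht, ?_, e, hgne, by field_simp; ring⟩
  set t := -(g e / h e) with htdef
  intro e' hne
  simp only [Pi.add_apply, Pi.smul_apply, smul_eq_mul] at hne ⊢
  have hg' : g e' ≠ 0 := fun h0 => hne (by simp [h0, hsupp e' h0])
  have hnn : 0 ≤ (g e' + t * h e') * g e' := by
    rcases lt_or_ge (g e' * h e') 0 with hl | hl
    · have := hmin e' hl
      rw [key e' hl, le_div_iff₀ (by linarith)] at this
      nlinarith
    · nlinarith [mul_nonneg ht.le hl, sq_nonneg (g e')]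
  exact lt_of_le_of_ne hnn (Ne.symm (mul_ne_zero hne hg'))

theorem aux_trans {m : ℕ} {f g k : Fin m → ℝ} (h1 : SignCompat f g) (h2 : SignCompat g k) :
    SignCompat f k := by
  intro e he
  have a := h1 e he
  have hg : g e ≠ 0 := by rintro h0; simp [h0] at a
  have b := h2 e hg
  have : 0 < (f e * k e) * (g e) ^ 2 := by nlinarith [mul_pos a b]
  exact pos_of_mul_pos_left this (by positivity)

theorem aux_refl {m : ℕ} (f : Fin m → ℝ) : SignCompat f f :=
  fun e he => mul_self_pos.2 he

theorem aux_exists {n m : ℕ} (A : Matrix (Fin n) (Fin m) ℝ) (b : Fin n → ℝ)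
    (hrank : A.rank = n) : ∀ (k : ℕ) (g : Fin m → ℝ), A.mulVec g = b →
    (Finset.univ.filter fun e => g e ≠ 0).card = k →
    ∃ f, IsBFS A b f ∧ SignCompat f g := by
  intro k
  induction k using Nat.strong_induction_on with
  | _ k ih =>
  intro g hg hk
  rcases aux_bfs_or_ker A b hrank g hg with hb | ⟨h, hA, hne, hs⟩
  · exact ⟨g, hb, aux_refl g⟩
  have : ∃ h : Fin m → ℝ, A.mulVec h = 0 ∧ (∀ e, g e = 0 → h e = 0) ∧ ∃ e, g e * h e < 0 := by
    obtain ⟨e, he⟩ := Function.ne_iff.1 hne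
    have hge : g e ≠ 0 := fun h0 => he (hs e h0)
    rcases lt_or_gt_of_ne (mul_ne_zero hge he) with hl | hl
    · exact ⟨h, hA, hs, e, hl⟩
    · exact ⟨-h, by rw [Matrix.mulVec_neg, hA, neg_zero], fun e h0 => by simp [hs e h0], e,
        by simpa using hl⟩
  obtain ⟨h, hA, hs, hneg⟩ := this
  obtain ⟨t, ht, hsc, e, hge, hz⟩ := aux_move g h hs hneg
  obtain ⟨f, hf, hfc⟩ := ih _ (by
    rw [← hk]
    refine Finset.card_lt_card (Finset.ssubset_iff_subset_ne.2 ⟨?_, ?_⟩)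
      (s := Finset.univ.filter fun e => (g + t • h) e ≠ 0)
    · intro e' he'
      simp only [Finset.mem_filter, Finset.mem_univ, true_and] at he' ⊢
      intro h0
      have := hsc e' he'
      simp [h0] at this
    · intro heq
      have : e ∈ Finset.univ.filter fun e => (g + t • h) e ≠ 0 := by
        rw [heq]; simpa using hge
      simp [hz] at this) (g + t • h)
    (by rw [Matrix.mulVec_add, Matrix.mulVec_smul, hA, hg]; simp) rfl
  exact ⟨f, hf, aux_trans hfc hsc⟩

theorem aux_abs {a b : ℝ} (h : a ≠ 0 → 0 < a * b) : |a| * |b| = a * b := by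
  rw [← abs_mul]
  apply abs_of_nonneg
  by_cases ha : a = 0
  · simp [ha]
  · exact (h ha).le

theorem aux_cost {n m : ℕ} (A : Matrix (Fin n) (Fin m) ℝ) (b : Fin n → ℝ) (c : Fin m → ℝ)
    (x : Fin m → ℝ) (q : Fin m → ℝ)
    (hqfeas : A.mulVec q = b ∧ ∀ e, x e = 0 → q e = 0)
    (hqmin : ∀ g : Fin m → ℝ, A.mulVec g = b → (∀ e, x e = 0 → g e = 0) →
      energyS c x q ≤ energyS c x g)
    (hfix : ∀ e, |q e| = x e) (f : Fin m → ℝ) (hf : A.mulVec f = b) (hfq : SignCompat f q) :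
    costVec c f = costVec c q := by
  set h := f - q with hh
  have hx0 : ∀ e, x e = 0 → f e = 0 := by
    intro e he
    by_contra hne
    have := hfq e hne
    simp [hqfeas.2 e he] at this
  set L := ∑ e, if x e = 0 then 0 else c e / x e * (q e * h e) with hL
  have hexp : ∀ t : ℝ, energyS c x (q + t • h) =
      energyS c x q + 2 * t * L + t ^ 2 * energyS c x h := by
    intro t
    simp only [energyS, hL, Finset.mul_sum, ← Finset.sum_add_distrib]
    refine Finset.sum_congr rfl fun e _ => ?_
    split_ifs
    · simp
    · simp only [Pi.add_apply, Pi.smul_apply, smul_eq_mul]; ring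
  have hge : ∀ t : ℝ, 0 ≤ 2 * t * L + t ^ 2 * energyS c x h := by
    intro t
    have := hqmin (q + t • h) (by
      rw [Matrix.mulVec_add, Matrix.mulVec_smul, hh, Matrix.mulVec_sub, hf, hqfeas.1]; simp)
      (fun e he => by simp [hh, hqfeas.2 e he, hx0 e he])
    rw [hexp] at this
    linarith
  have hL0 : L = 0 := by
    set Q := energyS c x h
    by_contra hne
    have h1 := hge (-L / (|Q| + 1))
    have hp : 0 < |Q| + 1 := by positivity
    have : 2 * (-L / (|Q| + 1)) * L + (-L / (|Q| + 1)) ^ 2 * Q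
        = (L / (|Q| + 1)) ^ 2 * (Q - 2 * (|Q| + 1)) := by field_simp; ring
    rw [this] at h1
    have h2 : 0 < (L / (|Q| + 1)) ^ 2 := by positivity
    nlinarith [le_abs_self Q, abs_nonneg Q]
  have : costVec c f - costVec c q = L := by
    simp only [costVec, hL, ← Finset.sum_sub_distrib]
    refine Finset.sum_congr rfl fun e _ => ?_
    split_ifs with h0
    · simp [hqfeas.2 e h0, hx0 e h0]
    · have h1 := aux_abs (hfq e)
      have h2 := abs_mul_abs_self (q e)
      rw [hfix e] at h1 h2
      rw [hfix e]
      simp only [hh, Pi.sub_apply]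
      have : q e * (f e - q e) = |f e| * x e - x e * x e := by rw [h1, h2]; ring
      rw [this]
      field_simp
  linarith

/-- If distinct basic feasible solutions have distinct costs and
`x ≥ 0` is such that the minimum energy solution `q` w.r.t. `x` satisfies
`|q_e| = x_e` for all `e`, then `x = |f|` for some basic feasible solution `f`. -/
theorem fixed_point_is_bfs_abs {n m : ℕ} (hnm : n ≤ m)
    (A : Matrix (Fin n) (Fin m) ℝ) (b : Fin n → ℝ) (c : Fin m → ℝ)
    (hAZ : ∀ i j, ∃ z : ℤ, A i j = (z : ℝ))
    (hbZ : ∀ i, ∃ z : ℤ, b i = (z : ℝ))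
    (hcZ : ∀ e, ∃ z : ℤ, c e = (z : ℝ))
    (hc1 : ∀ e, 1 ≤ c e)
    (hrank : A.rank = n)
    (hdistinct : ∀ f g : Fin m → ℝ, IsBFS A b f → IsBFS A b g → f ≠ g →
      costVec c f ≠ costVec c g)
    (x : Fin m → ℝ) (hx : ∀ e, 0 ≤ x e)
    (q : Fin m → ℝ)
    (hqfeas : A.mulVec q = b ∧ ∀ e, x e = 0 → q e = 0)
    (hqmin : ∀ g : Fin m → ℝ, A.mulVec g = b → (∀ e, x e = 0 → g e = 0) →
      energyS c x q ≤ energyS c x g)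
    (hfix : ∀ e, |q e| = x e) :
    ∃ f : Fin m → ℝ, IsBFS A b f ∧ ∀ e, x e = |f e| := by
  by_cases hq : IsBFS A b q
  · exact ⟨q, hq, fun e => (hfix e).symm⟩
  exfalso
  have hcost := aux_cost A b c x q hqfeas hqmin hfix
  obtain ⟨f1, hf1, hc1q⟩ := aux_exists A b hrank _ q hqfeas.1 rfl
  have hne : f1 ≠ q := by rintro rfl; exact hq hf1
  have hz : ∀ e, q e = 0 → f1 e = 0 := by
    intro e he
    by_contra hn
    have := hc1q e hn
    simp [he] at this
  have hneg : ∃ e, q e * (q - f1) e < 0 := by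
    by_contra hcon
    push Not at hcon
    have hle : ∀ e, |f1 e| ≤ |q e| := by
      intro e
      have h1 := aux_abs (hc1q e)
      have h2 := abs_mul_abs_self (q e)
      have h3 := hcon e
      simp only [Pi.sub_apply] at h3
      by_cases h0 : q e = 0
      · simp [hz e h0]
      · have : 0 < |q e| := abs_pos.2 h0
        nlinarith
    have heq := hcost f1 hf1.1 hc1q
    have hle2 : ∀ e ∈ Finset.univ, c e * |f1 e| ≤ c e * |q e| := fun e _ =>
      mul_le_mul_of_nonneg_left (hle e) (by linarith [hc1 e])
    have h4 := (Finset.sum_eq_sum_iff_of_le hle2).1 heq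
    apply hne
    ext e
    have h5 := h4 e (Finset.mem_univ _)
    have h6 : |f1 e| = |q e| := mul_left_cancel₀ (by linarith [hc1 e]) h5
    by_cases h0 : q e = 0
    · rw [h0, hz e h0]
    · have h7 := hc1q e (by rintro h; apply h0; rw [h, abs_zero] at h6; exact abs_eq_zero.1 h6.symm)
      rcases abs_eq_abs.1 h6 with h | h
      · exact h
      · rw [h] at h7; nlinarith [sq_nonneg (q e)]
  obtain ⟨t, ht, hsc, e, hqe, hte⟩ := aux_move q (q - f1) (fun e he => by simp [he, hz e he]) hneg
  obtain ⟨f2, hf2, hc2⟩ := aux_exists A b hrank _ (q + t • (q - f1))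
    (by rw [Matrix.mulVec_add, Matrix.mulVec_smul, Matrix.mulVec_sub, hf1.1, hqfeas.1]; simp) rfl
  have hf2e : f2 e = 0 := by
    by_contra hn
    have := hc2 e hn
    simp only [Pi.add_apply, Pi.smul_apply, smul_eq_mul] at this
    rw [hte] at this
    simp at this
  refine hdistinct f1 f2 hf1 hf2 ?_ ?_
  · rintro rfl
    simp only [Pi.sub_apply, hf2e, sub_zero] at hte
    have : (1 + t) * q e = 0 := by linarith
    rcases mul_eq_zero.1 this with h | h
    · linarith
    · exact hqe h
  · rw [hcost f1 hf1.1 hc1q, hcost f2 hf2.1 (aux_trans hc2 hsc)]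
end

section
/- Assume that any two distinct basic feasible solutions of Af = b have distinct cost. Then the set of fixed points, i.e., the set of x ∈ ℝ^m with x ≥ 0 such that the minimum energy solution q with respect to x exists and satisfies |q| = x, equals the set {|f| : f is a basic feasible solution of Af = b} and in particular is a finite (hence discrete) subset of ℝ^m. -/
open Matrix Filter Set

lemma aux_mulVec_B {n m : ℕ} (A : Matrix (Fin n) (Fin m) ℝ) (B : Fin n → Fin m)
    (hB : Function.Injective B) (f : Fin m → ℝ) (hf : ∀ e, (∀ i, B i ≠ e) → f e = 0) :
    (A.submatrix id B).mulVec (fun i => f (B i)) = A.mulVec f := by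
  ext i
  simp only [Matrix.mulVec, dotProduct, Matrix.submatrix_apply, id]
  apply Fintype.sum_of_injective B hB
  · intro e he
    rw [hf e (fun j hj => he ⟨j, hj⟩), mul_zero]
  · intro j; rfl

lemma aux_ker_B {n m : ℕ} (A : Matrix (Fin n) (Fin m) ℝ) (B : Fin n → Fin m)
    (hB : Function.Injective B) (hu : IsUnit (A.submatrix id B).det)
    (f : Fin m → ℝ) (hf : ∀ e, (∀ i, B i ≠ e) → f e = 0) (h0 : A.mulVec f = 0) : f = 0 := by
  rw [← aux_mulVec_B A B hB f hf] at h0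
  have h1 : (fun i => f (B i)) = 0 := by
    have := congrArg (fun v => (A.submatrix id B)⁻¹.mulVec v) h0
    simpa [Matrix.mulVec_mulVec, Matrix.nonsing_inv_mul _ hu] using this
  ext e
  by_cases he : ∃ i, B i = e
  · obtain ⟨i, rfl⟩ := he
    exact congrFun h1 i
  · push Not at he
    exact hf e he

lemma aux_bfs {n m : ℕ} (A : Matrix (Fin n) (Fin m) ℝ) (b : Fin n → ℝ) (hrank : A.rank = n)
    (g : Fin m → ℝ) (hg : A.mulVec g = b)
    (hind : ∀ h : Fin m → ℝ, A.mulVec h = 0 → (∀ e, g e = 0 → h e = 0) → h = 0) :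
    IsBFS A b g := by
  have hli : LinearIndepOn ℝ A.col {e | g e ≠ 0} := by
    rw [linearIndepOn_iff]
    intro l hl hl0
    have := hind l ?_ ?_
    · ext e; exact congrFun this e
    · rw [← hl0, Finsupp.linearCombination_apply, Finsupp.sum_fintype _ _ (by simp)]
      ext i
      simp [Matrix.mulVec, dotProduct, Finset.sum_apply, mul_comm, Matrix.col]
    · intro e he
      by_contra hne
      have := (Finsupp.mem_supported _ _).1 hl (Finsupp.mem_support_iff.2 hne)
      exact this he
  obtain ⟨S, -, hsS, hspan, hS⟩ := exists_linearIndepOn_extension hli (Set.subset_univ _)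
  have hfin : Module.finrank ℝ (Submodule.span ℝ (A.col '' S)) = n := by
    have : Submodule.span ℝ (A.col '' S) = Submodule.span ℝ (Set.range A.col) := by
      apply le_antisymm
      · exact Submodule.span_mono (Set.image_subset_range _ _)
      · rw [Submodule.span_le, ← Set.image_univ]; exact hspan
    rw [this, ← Matrix.rank_eq_finrank_span_cols, hrank]
  classical
  have hcard : Fintype.card S = n := by
    have h1 := finrank_span_eq_card (R := ℝ) (b := fun x : S => A.col x) hS
    rw [Set.image_eq_range] at hfin
    exact h1.symm.trans hfin
  let φ : Fin n ≃ S := (Fintype.equivFinOfCardEq hcard).symm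
  have hBinj : Function.Injective (fun i => (φ i : Fin m)) :=
    Subtype.val_injective.comp φ.injective
  have hu : IsUnit (A.submatrix id (fun i => (φ i : Fin m))).det := by
    rw [← Matrix.isUnit_iff_isUnit_det, ← Matrix.linearIndependent_cols_iff_isUnit]
    exact LinearIndependent.comp hS φ φ.injective
  have hz : ∀ e, (∀ i, (φ i : Fin m) ≠ e) → g e = 0 := by
    intro e he
    by_contra hne
    exact he (φ.symm ⟨e, hsS hne⟩) (by simp)
  refine ⟨hg, fun i => (φ i : Fin m), hBinj, hu, ?_, hz⟩
  intro i
  rw [← hg, ← aux_mulVec_B A _ hBinj g hz, Matrix.mulVec_mulVec, Matrix.nonsing_inv_mul _ hu,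
    Matrix.one_mulVec]

lemma aux_eps {m : ℕ} (g h : Fin m → ℝ) (hs : ∀ e, g e = 0 → h e = 0) :
    ∃ ε : ℝ, 0 < ε ∧ ∀ e, ε * |h e| ≤ |g e| := by
  have : ∀ᶠ ε in nhdsWithin (0:ℝ) (Set.Ioi 0), ∀ e, ε * |h e| ≤ |g e| := by
    rw [Filter.eventually_all]
    intro e
    by_cases he : g e = 0
    · simp [he, hs e he]
    · have hc : Filter.Tendsto (fun ε : ℝ => ε * |h e|) (nhdsWithin 0 (Set.Ioi 0)) (nhds 0) := by
        have : Filter.Tendsto (fun ε : ℝ => ε * |h e|) (nhds 0) (nhds (0 * |h e|)) :=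
          (continuous_id.mul continuous_const).tendsto 0
        rw [zero_mul] at this
        exact this.mono_left nhdsWithin_le_nhds
      exact hc.eventually_le_const (abs_pos.2 he)
  obtain ⟨ε, h1, h2⟩ := (this.and self_mem_nhdsWithin).exists
  exact ⟨ε, h2, h1⟩

lemma aux_sign (a u q : ℝ) (h : |a| ≤ |u|) (hu : 0 ≤ u * q) : 0 ≤ (u + a) * q := by
  rcases lt_trichotomy q 0 with hq | hq | hq
  · have : u ≤ 0 := by nlinarith
    rw [abs_of_nonpos this] at h
    have := (abs_le.1 h).2
    nlinarith
  · simp [hq]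
  · have : 0 ≤ u := by nlinarith
    rw [abs_of_nonneg this] at h
    have := (abs_le.1 h).1
    nlinarith

lemma aux_first {n m : ℕ} (A : Matrix (Fin n) (Fin m) ℝ) (b : Fin n → ℝ) (c q : Fin m → ℝ)
    (hq : A.mulVec q = b)
    (hmin : ∀ g : Fin m → ℝ, A.mulVec g = b → (∀ e, q e = 0 → g e = 0) →
      ∑ e, c e / |q e| * q e ^ 2 ≤ ∑ e, c e / |q e| * g e ^ 2)
    (h : Fin m → ℝ) (h0 : A.mulVec h = 0) (hs : ∀ e, q e = 0 → h e = 0) :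
    ∑ e, c e * (h e * q e / |q e|) = 0 := by
  have key : ∀ t : ℝ, 0 ≤ (∑ e, c e / |q e| * h e ^ 2) * (t * t)
      + (2 * ∑ e, c e * (h e * q e / |q e|)) * t + 0 := by
    intro t
    have := hmin (q + t • h) (by rw [Matrix.mulVec_add, Matrix.mulVec_smul, h0, hq]; simp)
      (by intro e he; simp [he, hs e he])
    have e1 : ∑ e, c e / |q e| * (q + t • h) e ^ 2 = ∑ e, c e / |q e| * q e ^ 2 +
      ((∑ e, c e / |q e| * h e ^ 2) * (t * t)
      + (2 * ∑ e, c e * (h e * q e / |q e|)) * t) := by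
      rw [Finset.mul_sum, Finset.sum_mul, Finset.sum_mul, ← Finset.sum_add_distrib,
        ← Finset.sum_add_distrib]
      apply Finset.sum_congr rfl
      intro e _
      simp only [Pi.add_apply, Pi.smul_apply, smul_eq_mul, div_eq_mul_inv]
      ring
    linarith
  have := discrim_le_zero key
  unfold discrim at this
  nlinarith [sq_nonneg (∑ e, c e * (h e * q e / |q e|))]

lemma aux_main_s6 {n m : ℕ} (A : Matrix (Fin n) (Fin m) ℝ) (b : Fin n → ℝ) (c q : Fin m → ℝ)
    (hc1 : ∀ e, 1 ≤ c e) (hrank : A.rank = n)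
    (hdistinct : ∀ f g : Fin m → ℝ, IsBFS A b f → IsBFS A b g → f ≠ g →
      costVec c f ≠ costVec c g)
    (hq : A.mulVec q = b)
    (hfo : ∀ h : Fin m → ℝ, A.mulVec h = 0 → (∀ e, q e = 0 → h e = 0) →
      ∑ e, c e * (h e * q e / |q e|) = 0) : IsBFS A b q := by
  apply aux_bfs A b hrank q hq
  intro h h0 hs
  let P : Set (Fin m → ℝ) := {g | A.mulVec g = b ∧ ∀ e, (q e = 0 → g e = 0) ∧ 0 ≤ g e * q e}
  have hcost : ∀ g ∈ P, costVec c g = costVec c q := by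
    intro g hg
    have h1 := hfo (g - q) (by rw [Matrix.mulVec_sub, hg.1, hq, sub_self])
      (by intro e he; simp [he, (hg.2 e).1 he])
    rw [← sub_eq_zero, ← h1]
    unfold costVec
    rw [← Finset.sum_sub_distrib]
    apply Finset.sum_congr rfl
    intro e _
    by_cases he : q e = 0
    · simp [he, (hg.2 e).1 he]
    · have h2 : |g e| = g e * q e / |q e| := by
        rw [eq_div_iff (abs_ne_zero.2 he), ← abs_mul, abs_of_nonneg (hg.2 e).2]
      have h3 : |q e| = q e * q e / |q e| := by
        rw [eq_div_iff (abs_ne_zero.2 he), abs_mul_abs_self]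
      rw [h2]
      nth_rewrite 2 [h3]
      simp only [Pi.sub_apply]
      ring
  have hclosed : IsClosed P := by
    have : P = {g | A.mulVec g = b} ∩ ⋂ e, ({g | q e = 0 → g e = 0} ∩ {g | 0 ≤ g e * q e}) := by
      ext g; simp [P]
    rw [this]
    refine IsClosed.inter (isClosed_eq (by fun_prop) continuous_const)
      (isClosed_iInter fun e => IsClosed.inter ?_
        (isClosed_le continuous_const (by fun_prop)))
    by_cases he : q e = 0
    · simp only [he, true_imp_iff]
      exact isClosed_eq (by fun_prop) continuous_const
    · simp [he]
  have hcompact : IsCompact P := by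
    refine (isCompact_Icc (a := fun _ : Fin m => -costVec c q)
      (b := fun _ => costVec c q)).of_isClosed_subset hclosed ?_
    intro g hg
    have hb : ∀ e, |g e| ≤ costVec c q := by
      intro e
      rw [← hcost g hg]
      have h1 : c e * |g e| ≤ costVec c g :=
        Finset.single_le_sum (f := fun e => c e * |g e|)
          (fun i _ => mul_nonneg (by linarith [hc1 i]) (abs_nonneg _)) (Finset.mem_univ e)
      nlinarith [hc1 e, abs_nonneg (g e)]
    exact ⟨fun e => (abs_le.1 (hb e)).1, fun e => (abs_le.1 (hb e)).2⟩
  have hconv : Convex ℝ P := by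
    intro g hg g' hg' s t hs0 ht0 hst
    refine ⟨?_, fun e => ⟨fun he => ?_, ?_⟩⟩
    · rw [Matrix.mulVec_add, Matrix.mulVec_smul, Matrix.mulVec_smul, hg.1, hg'.1, ← add_smul,
        hst, one_smul]
    · simp [(hg.2 e).1 he, (hg'.2 e).1 he]
    · have h1 := mul_nonneg hs0 (hg.2 e).2
      have h2 := mul_nonneg ht0 (hg'.2 e).2
      simp only [Pi.add_apply, Pi.smul_apply, smul_eq_mul]
      nlinarith
  have hqP : q ∈ P := ⟨hq, fun e => ⟨id, mul_self_nonneg _⟩⟩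
  have hmove : ∀ g ∈ P, ∀ h : Fin m → ℝ, A.mulVec h = 0 → (∀ e, g e = 0 → h e = 0) →
      (∀ e, |h e| ≤ |g e|) → g + h ∈ P := by
    intro g hg h h0 hs hle
    refine ⟨by rw [Matrix.mulVec_add, h0, hg.1, add_zero], fun e => ⟨fun he => ?_, ?_⟩⟩
    · have := (hg.2 e).1 he
      simp [this, hs e this]
    · exact aux_sign _ _ _ (hle e) (hg.2 e).2
  have hext : ∀ g ∈ P.extremePoints ℝ, IsBFS A b g := by
    intro g hg
    apply aux_bfs A b hrank g hg.1.1
    intro h h0 hs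
    obtain ⟨ε, hε, hle⟩ := aux_eps g h hs
    have m1 : g + ε • h ∈ P := hmove g hg.1 _ (by rw [Matrix.mulVec_smul, h0, smul_zero])
      (fun e he => by simp [hs e he]) (fun e => by simpa [abs_mul, abs_of_pos hε] using hle e)
    have m2 : g + (-ε) • h ∈ P := hmove g hg.1 _ (by rw [Matrix.mulVec_smul, h0, smul_zero])
      (fun e he => by simp [hs e he]) (fun e => by simpa [abs_mul, abs_of_pos hε] using hle e)
    have := hg.2 m1 m2 ⟨1/2, 1/2, by norm_num, by norm_num, by norm_num, by
      ext e; simp; ring⟩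
    have h3 : ε • h = 0 := by simpa using this
    exact (smul_eq_zero.1 h3).resolve_left hε.ne'
  have hsub : (P.extremePoints ℝ).Subsingleton := by
    intro f hf g hg
    by_contra hne
    exact hdistinct f g (hext f hf) (hext g hg) hne
      ((hcost f hf.1).trans (hcost g hg.1).symm)
  have hPsub : P.Subsingleton := by
    rw [← closure_convexHull_extremePoints hcompact hconv]
    rcases hsub.eq_empty_or_singleton with h1 | ⟨x, h1⟩ <;> rw [h1] <;> simp
  obtain ⟨ε, hε, hle⟩ := aux_eps q h hs
  have m1 : q + ε • h ∈ P := hmove q hqP _ (by rw [Matrix.mulVec_smul, h0, smul_zero])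
      (fun e he => by simp [hs e he]) (fun e => by simpa [abs_mul, abs_of_pos hε] using hle e)
  have h3 : ε • h = 0 := by simpa using hPsub m1 hqP
  exact (smul_eq_zero.1 h3).resolve_left hε.ne'

lemma aux_energyS {m : ℕ} (c x f : Fin m → ℝ) : energyS c x f = ∑ e, c e / x e * f e ^ 2 := by
  unfold energyS
  apply Finset.sum_congr rfl
  intro e _
  split_ifs with h <;> simp [h]

/-- If distinct basic feasible solutions have distinct costs, the set of
fixed points (nonnegative `x` whose minimum energy solution `q` exists and satisfies
`|q| = x`) equals `{|f| : f basic feasible}` and is finite (hence discrete). -/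
theorem fixed_point_set_eq_and_finite {n m : ℕ} (hnm : n ≤ m)
    (A : Matrix (Fin n) (Fin m) ℝ) (b : Fin n → ℝ) (c : Fin m → ℝ)
    (hAZ : ∀ i j, ∃ z : ℤ, A i j = (z : ℝ))
    (hbZ : ∀ i, ∃ z : ℤ, b i = (z : ℝ))
    (hcZ : ∀ e, ∃ z : ℤ, c e = (z : ℝ))
    (hc1 : ∀ e, 1 ≤ c e)
    (hrank : A.rank = n)
    (hfeas : ∃ f : Fin m → ℝ, A.mulVec f = b)
    (hdistinct : ∀ f g : Fin m → ℝ, IsBFS A b f → IsBFS A b g → f ≠ g →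
      costVec c f ≠ costVec c g) :
    {x : Fin m → ℝ | (∀ e, 0 ≤ x e) ∧ ∃ q : Fin m → ℝ,
        (A.mulVec q = b ∧ ∀ e, x e = 0 → q e = 0) ∧
        (∀ g : Fin m → ℝ, A.mulVec g = b → (∀ e, x e = 0 → g e = 0) →
          energyS c x q ≤ energyS c x g) ∧
        ∀ e, |q e| = x e}
      = {x : Fin m → ℝ | ∃ f : Fin m → ℝ, IsBFS A b f ∧ x = fun e => |f e|} ∧
    Set.Finite {x : Fin m → ℝ | ∃ f : Fin m → ℝ, IsBFS A b f ∧ x = fun e => |f e|} := by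
  constructor
  · ext x
    simp only [Set.mem_ofPred_eq]
    constructor
    · rintro ⟨hx, q, ⟨hq, hq0⟩, hmin, habs⟩
      refine ⟨q, ?_, funext fun e => (habs e).symm⟩
      obtain rfl : x = fun e => |q e| := funext fun e => (habs e).symm
      refine aux_main_s6 A b c q hc1 hrank hdistinct hq (aux_first A b c q hq ?_)
      intro g hg hg0
      have := hmin g hg (fun e he => hg0 e (abs_eq_zero.1 he))
      rwa [aux_energyS, aux_energyS] at this
    · rintro ⟨f, ⟨hf, B, hB, hu, hfB, hfz⟩, rfl⟩
      refine ⟨fun e => abs_nonneg _, f, ⟨hf, fun e he => abs_eq_zero.1 he⟩, ?_, fun e => rfl⟩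
      intro g hg hg0
      have : g - f = 0 := by
        apply aux_ker_B A B hB hu
        · intro e he
          have h1 := hfz e he
          have h2 := hg0 e (by simp [h1])
          simp [h1, h2]
        · rw [Matrix.mulVec_sub, hg, hf, sub_self]
      rw [sub_eq_zero.1 this]
  · have hfin : Set.Finite {f | IsBFS A b f} := by
      refine Set.Finite.subset (Set.finite_iUnion (ι := Fin n → Fin m)
        (f := fun B => {f : Fin m → ℝ | (∀ i, f (B i) = (A.submatrix id B)⁻¹.mulVec b i) ∧
          ∀ e, (∀ i, B i ≠ e) → f e = 0}) ?_) ?_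
      · intro B
        apply Set.Subsingleton.finite
        rintro f ⟨h1, h2⟩ g ⟨h3, h4⟩
        ext e
        by_cases he : ∃ i, B i = e
        · obtain ⟨i, rfl⟩ := he
          rw [h1, h3]
        · push Not at he
          rw [h2 e he, h4 e he]
      · rintro f ⟨_, B, _, _, h1, h2⟩
        exact Set.mem_iUnion.2 ⟨B, h1, h2⟩
    refine (hfin.image (fun f e => |f e|)).subset ?_
    rintro x ⟨f, hf, rfl⟩
    exact ⟨f, hf, rfl⟩
end

section
/- Let a : [m] × ℝ^m × ℝ → ℝ be Lipschitz-continuous with 0 ≤ a_e(x,t) ≤ C for a constant C and all e, x, t, and let x(0) ∈ ℝ^m with x_e(0) > 0 for all e. Then the non-uniform Physarum dynamics ẋ_e(t) = a_e(x(t), t)·(|q_e(x(t))| − x_e(t)) has a unique solution x : [0,∞) → ℝ^m with the given initial value, and x_e(t) > 0 for all e and all t ≥ 0. -/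
open Matrix Filter Set

lemma phys_orth {n m : ℕ} {A : Matrix (Fin n) (Fin m) ℝ} {b : Fin n → ℝ} {c x q g : Fin m → ℝ}
    (hc1 : ∀ e, 1 ≤ c e) (hx : ∀ e, 0 < x e)
    (hq : A.mulVec q = b)
    (hmin : ∀ f : Fin m → ℝ, A.mulVec f = b → energy c x q ≤ energy c x f)
    (hg : A.mulVec g = 0) : ∑ e, c e / x e * q e * g e = 0 := by
  set p := ∑ e, c e / x e * q e * g e with hp
  set r := ∑ e, c e / x e * g e ^ 2 with hr
  have hr0 : 0 ≤ r := Finset.sum_nonneg fun e _ => by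
    have := hx e; have := hc1 e; positivity
  have key : ∀ s : ℝ, 0 ≤ 2 * s * p + s ^ 2 * r := by
    intro s
    have h := hmin (q + s • g) (by rw [Matrix.mulVec_add, Matrix.mulVec_smul, hq, hg]; simp)
    have h2 : energy c x (q + s • g) = energy c x q + (2 * s * p + s ^ 2 * r) := by
      simp only [energy, hp, hr, Finset.mul_sum, ← Finset.sum_add_distrib]
      refine Finset.sum_congr rfl fun e _ => ?_
      simp only [Pi.add_apply, Pi.smul_apply, smul_eq_mul]
      ring
    linarith
  have h := key (-p / (r + 1))
  have hr1 : 0 < r + 1 := by linarith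
  have h3 : 2 * (-p / (r + 1)) * p + (-p / (r + 1)) ^ 2 * r = - (p ^ 2 * (r + 2)) / (r + 1) ^ 2 := by
    field_simp; ring
  rw [h3] at h
  by_contra hne
  have : 0 < p ^ 2 * (r + 2) / (r + 1) ^ 2 := by positivity
  rw [neg_div] at h
  linarith

lemma phys_qbound {n m : ℕ} {A : Matrix (Fin n) (Fin m) ℝ} {b : Fin n → ℝ} {c x q f : Fin m → ℝ}
    {δ : ℝ} (hδ : 0 < δ)
    (hc1 : ∀ e, 1 ≤ c e) (hx : ∀ e, δ ≤ x e) (hf : A.mulVec f = b)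
    (hmin : ∀ f : Fin m → ℝ, A.mulVec f = b → energy c x q ≤ energy c x f) (e : Fin m) :
    |q e| ≤ (∑ e, c e / δ * f e ^ 2) + x e := by
  have hx0 : ∀ e, 0 < x e := fun e => hδ.trans_le (hx e)
  set B := ∑ e, c e / δ * f e ^ 2 with hB
  have hB0 : 0 ≤ B := Finset.sum_nonneg fun e _ => by have := hc1 e; positivity
  have h1 : energy c x f ≤ B := by
    refine Finset.sum_le_sum fun e _ => ?_
    have := hc1 e
    have := hx e
    gcongr
  have h2 : c e / x e * q e ^ 2 ≤ energy c x q := by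
    refine Finset.single_le_sum (f := fun e => c e / x e * q e ^ 2) (fun e _ => ?_) (Finset.mem_univ e)
    have := hx0 e; have := hc1 e; positivity
  have h3 : 1 / x e * q e ^ 2 ≤ B := by
    have : 1 / x e * q e ^ 2 ≤ c e / x e * q e ^ 2 := by
      have := hx0 e; have := hc1 e; gcongr
    linarith [hmin f hf]
  have hxe := hx0 e
  have h4 : q e ^ 2 ≤ B * x e := by
    have := mul_le_mul_of_nonneg_right h3 hxe.le
    field_simp at this
    linarith
  apply abs_le_of_sq_le_sq _ (by positivity) 
  nlinarith

lemma phys_qlip {n m : ℕ} (A : Matrix (Fin n) (Fin m) ℝ) (b : Fin n → ℝ) (c : Fin m → ℝ)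
    (hc1 : ∀ e, 1 ≤ c e)
    (f : Fin m → ℝ) (hf : A.mulVec f = b)
    (q : (Fin m → ℝ) → Fin m → ℝ)
    (hq : ∀ x : Fin m → ℝ, (∀ e, 0 < x e) →
      A.mulVec (q x) = b ∧
      ∀ f : Fin m → ℝ, A.mulVec f = b → energy c x (q x) ≤ energy c x f)
    (δ R : ℝ) (hδ : 0 < δ) (hR : 0 < R) :
    ∃ L : ℝ, 0 ≤ L ∧ ∀ x y : Fin m → ℝ, (∀ e, δ ≤ x e ∧ x e ≤ R) → (∀ e, δ ≤ y e ∧ y e ≤ R) →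
      ‖q x - q y‖ ≤ L * ‖x - y‖ := by
  set B := ∑ e, c e / δ * f e ^ 2 with hB
  have hB0 : 0 ≤ B := Finset.sum_nonneg fun e _ => by have := hc1 e; positivity
  have hc0 : 0 ≤ ∑ e, c e := Finset.sum_nonneg fun e _ => by linarith [hc1 e]
  refine ⟨R * ((∑ e, c e) / δ ^ 2 * (B + R)), by positivity, fun x y hx hy => ?_⟩
  have hx0 : ∀ e, 0 < x e := fun e => hδ.trans_le (hx e).1
  have hy0 : ∀ e, 0 < y e := fun e => hδ.trans_le (hy e).1
  obtain ⟨hqx, hmx⟩ := hq x hx0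
  obtain ⟨hqy, hmy⟩ := hq y hy0
  set d := q x - q y with hd
  have hAd : A.mulVec d = 0 := by rw [hd, Matrix.mulVec_sub, hqx, hqy, sub_self]
  have ox := phys_orth hc1 hx0 hqx hmx hAd
  have oy := phys_orth hc1 hy0 hqy hmy hAd
  have hQ : ∀ e, |q y e| ≤ B + R := fun e =>
    (phys_qbound hδ hc1 (fun e => (hy e).1) hf hmy e).trans (by linarith [(hy e).2])
  have h1 : ∑ e, c e / x e * d e ^ 2 = ∑ e, c e * ((x e - y e) / (x e * y e)) * q y e * d e := by
    have : ∑ e, c e / x e * d e ^ 2 - ∑ e, c e * ((x e - y e) / (x e * y e)) * q y e * d e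
      = ∑ e, c e / x e * q x e * d e - ∑ e, c e / y e * q y e * d e := by
      rw [← Finset.sum_sub_distrib, ← Finset.sum_sub_distrib]
      refine Finset.sum_congr rfl fun e _ => ?_
      have := (hx0 e).ne'; have := (hy0 e).ne'
      have h : d e = q x e - q y e := rfl
      rw [h]; field_simp; ring
    rw [ox, oy] at this
    linarith
  have h2 : ∑ e, c e * ((x e - y e) / (x e * y e)) * q y e * d e
      ≤ ∑ e, c e * (‖x - y‖ / δ ^ 2 * (B + R) * ‖d‖) := by
    refine Finset.sum_le_sum fun e _ => ?_
    have hce : 0 ≤ c e := by linarith [hc1 e]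
    rw [mul_assoc, mul_assoc]
    refine mul_le_mul_of_nonneg_left (le_trans (le_abs_self _) ?_) hce
    rw [abs_mul, abs_mul, ← mul_assoc]
    have e1 : |x e - y e| ≤ ‖x - y‖ := norm_le_pi_norm (x - y) e
    have e2 : |d e| ≤ ‖d‖ := norm_le_pi_norm d e
    have e3 : |(x e - y e) / (x e * y e)| ≤ ‖x - y‖ / δ ^ 2 := by
      rw [abs_div, abs_of_pos (mul_pos (hx0 e) (hy0 e)), pow_two]
      have := (hx e).1; have := (hy e).1; have := (hx0 e).le
      gcongr
    have := hQ e
    gcongr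
  rw [← Finset.sum_mul] at h2
  have h3 : ∀ e, |d e| ^ 2 ≤ R * ∑ e, c e / x e * d e ^ 2 := by
    intro e
    have h4 : c e / x e * d e ^ 2 ≤ ∑ e, c e / x e * d e ^ 2 := by
      refine Finset.single_le_sum (f := fun e => c e / x e * d e ^ 2) (fun e _ => ?_)
        (Finset.mem_univ e)
      have := hx0 e; have := hc1 e; positivity
    have h5 : 1 ≤ R * (c e / x e) := by
      rw [← mul_div_assoc, le_div_iff₀ (hx0 e)]
      nlinarith [(hx e).2, hc1 e]
    rw [sq_abs]
    nlinarith [sq_nonneg (d e)]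
  set W := R * ((∑ e, c e) / δ ^ 2 * (B + R)) * ‖x - y‖ with hW
  have hW0 : 0 ≤ W := by positivity
  have h6 : ∀ e, |d e| ^ 2 ≤ W * ‖d‖ := by
    intro e
    refine (h3 e).trans ?_
    rw [h1]
    calc _ ≤ R * ((∑ e, c e) * (‖x - y‖ / δ ^ 2 * (B + R) * ‖d‖)) := by gcongr
      _ = _ := by rw [hW]; ring
  have h7 : ‖d‖ ≤ Real.sqrt (W * ‖d‖) := by
    refine (pi_norm_le_iff_of_nonneg (Real.sqrt_nonneg _)).2 fun e => ?_
    exact Real.le_sqrt_of_sq_le (h6 e)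
  have h8 : ‖d‖ ^ 2 ≤ W * ‖d‖ := by
    have := Real.sq_sqrt (show 0 ≤ W * ‖d‖ by positivity)
    nlinarith [norm_nonneg d, Real.sqrt_nonneg (W * ‖d‖)]
  by_contra hcon
  push Not at hcon
  nlinarith

lemma phys_Glip {n m : ℕ} (A : Matrix (Fin n) (Fin m) ℝ) (b : Fin n → ℝ) (c : Fin m → ℝ)
    (hc1 : ∀ e, 1 ≤ c e)
    (f : Fin m → ℝ) (hf : A.mulVec f = b)
    (q : (Fin m → ℝ) → Fin m → ℝ)
    (hq : ∀ x : Fin m → ℝ, (∀ e, 0 < x e) →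
      A.mulVec (q x) = b ∧
      ∀ f : Fin m → ℝ, A.mulVec f = b → energy c x (q x) ≤ energy c x f)
    (a : Fin m → (Fin m → ℝ) → ℝ → ℝ) (K : NNReal) (C : ℝ) (hC : 0 ≤ C)
    (haL : ∀ e, LipschitzWith K (fun p : (Fin m → ℝ) × ℝ => a e p.1 p.2))
    (hab : ∀ e (x : Fin m → ℝ) (t : ℝ), 0 ≤ a e x t ∧ a e x t ≤ C)
    (δ R : ℝ) (hδ : 0 < δ) (hR : 0 < R) :
    ∃ L : NNReal, ∀ t : ℝ, LipschitzOnWith L (fun x e => a e x t * (|q x e| - x e))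
      {x : Fin m → ℝ | ∀ e, δ ≤ x e ∧ x e ≤ R} := by
  obtain ⟨L, hL0, hL⟩ := phys_qlip A b c hc1 f hf q hq δ R hδ hR
  set B := ∑ e, c e / δ * f e ^ 2 with hB
  have hB0 : 0 ≤ B := Finset.sum_nonneg fun e _ => by have := hc1 e; positivity
  have hN : 0 ≤ C * (L + 1) + K * (B + R + R) := by positivity
  refine ⟨⟨_, hN⟩, fun t => LipschitzOnWith.of_dist_le_mul fun x hx y hy => ?_⟩
  rw [dist_eq_norm, dist_eq_norm]
  refine (pi_norm_le_iff_of_nonneg (by positivity)).2 fun e => ?_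
  have hqy := phys_qbound hδ hc1 (fun e => (hy e).1) hf (hq y fun e => hδ.trans_le (hy e).1).2 e
  have h1 : |q x e - q y e| ≤ L * ‖x - y‖ := (norm_le_pi_norm (q x - q y) e).trans (hL x y hx hy)
  have h2 : |x e - y e| ≤ ‖x - y‖ := norm_le_pi_norm (x - y) e
  have h3 : |a e x t - a e y t| ≤ K * ‖x - y‖ := by
    have := (haL e).dist_le_mul (x, t) (y, t)
    simpa [Prod.dist_eq, dist_eq_norm] using this
  have h4 : |(|q x e| - x e) - (|q y e| - y e)| ≤ (L + 1) * ‖x - y‖ := by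
    have := abs_abs_sub_abs_le_abs_sub (q x e) (q y e)
    have h : (|q x e| - x e) - (|q y e| - y e) = (|q x e| - |q y e|) - (x e - y e) := by ring
    rw [h]
    refine (abs_sub _ _).trans ?_
    linarith
  have h5 : |(|q y e| - y e)| ≤ B + R + R := by
    have := hy e
    rw [abs_le]; constructor <;> linarith [abs_nonneg (q y e)]
  have h6 : |a e x t| ≤ C := by rw [abs_of_nonneg (hab e x t).1]; exact (hab e x t).2
  simp only [Pi.sub_apply, Real.norm_eq_abs]
  calc _ = |a e x t * ((|q x e| - x e) - (|q y e| - y e)) +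
        (a e x t - a e y t) * (|q y e| - y e)| := by congr 1; ring
    _ ≤ |a e x t| * |(|q x e| - x e) - (|q y e| - y e)| +
        |a e x t - a e y t| * |(|q y e| - y e)| := by
        rw [← abs_mul, ← abs_mul]; exact abs_add_le _ _
    _ ≤ C * ((L + 1) * ‖x - y‖) + (K * ‖x - y‖) * (B + R + R) := by gcongr
    _ = (C * (L + 1) + K * (B + R + R)) * ‖x - y‖ := by ring

lemma phys_unique {m : ℕ} (G : ℝ → (Fin m → ℝ) → Fin m → ℝ)
    (hlip : ∀ δ R : ℝ, 0 < δ → 0 < R → ∃ L : NNReal, ∀ t : ℝ, LipschitzOnWith L (G t)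
      {x : Fin m → ℝ | ∀ e, δ ≤ x e ∧ x e ≤ R})
    (T : ℝ) (f g : ℝ → Fin m → ℝ) (h0 : f 0 = g 0)
    (hf : ∀ t ∈ Icc 0 T, (∀ e, 0 < f t e) ∧ HasDerivWithinAt f (G t (f t)) (Icc 0 T) t)
    (hg : ∀ t ∈ Icc 0 T, (∀ e, 0 < g t e) ∧ HasDerivWithinAt g (G t (g t)) (Icc 0 T) t) :
    EqOn f g (Icc 0 T) := by
  have hcf : ContinuousOn f (Icc 0 T) := fun t ht => (hf t ht).2.continuousWithinAt
  have hcg : ContinuousOn g (Icc 0 T) := fun t ht => (hg t ht).2.continuousWithinAt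
  have box : ∀ f : ℝ → Fin m → ℝ, ContinuousOn f (Icc 0 T) → (∀ t ∈ Icc 0 T, ∀ e, 0 < f t e) →
      ∃ N : ℝ, 0 < N ∧ ∀ t ∈ Icc 0 T, ∀ e, N⁻¹ ≤ f t e ∧ f t e ≤ N := by
    intro f hcf hpos
    have hfe : ∀ e, ContinuousOn (fun t => f t e) (Icc 0 T) := fun e =>
      (continuous_apply e).comp_continuousOn hcf
    have hh : ContinuousOn (fun t => ∑ e, (f t e + (f t e)⁻¹)) (Icc 0 T) :=
      continuousOn_finsetSum _ fun e _ =>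
        (hfe e).add ((hfe e).inv₀ fun t ht => (hpos t ht e).ne')
    obtain ⟨M, hM⟩ := isCompact_Icc.exists_bound_of_continuousOn hh
    refine ⟨|M| + 1, by positivity, fun t ht e => ?_⟩
    have h1 := (le_abs_self _).trans (hM t ht)
    have h2 : f t e + (f t e)⁻¹ ≤ ∑ e, (f t e + (f t e)⁻¹) :=
      Finset.single_le_sum (f := fun e => f t e + (f t e)⁻¹)
        (fun e _ => by have := hpos t ht e; positivity) (Finset.mem_univ e)
    have h3 := hpos t ht e
    have h4 : 0 < (f t e)⁻¹ := by positivity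
    have h5 := le_abs_self M
    constructor
    · exact inv_le_of_inv_le₀ h3 (by linarith)
    · linarith
  obtain ⟨N, hN, hNf⟩ := box f hcf fun t ht => (hf t ht).1
  obtain ⟨N', hN', hNg⟩ := box g hcg fun t ht => (hg t ht).1
  have hP : 0 < max N N' := lt_max_of_lt_left hN
  obtain ⟨L, hL⟩ := hlip (max N N')⁻¹ (max N N') (by positivity) hP
  refine ODE_solution_unique_of_mem_Icc_right (v := G) (K := L)
    (s := fun _ => {x | ∀ e, (max N N')⁻¹ ≤ x e ∧ x e ≤ max N N'}) (fun t _ => hL t)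
    hcf (fun t ht => ?_) (fun t ht e => ?_) hcg (fun t ht => ?_) (fun t ht e => ?_) h0
  · exact (hf t ⟨ht.1, ht.2.le⟩).2.mono_of_mem_nhdsWithin
      (mem_of_superset (Icc_mem_nhdsGE ht.2) (Icc_subset_Icc_left ht.1))
  · have := hNf t ⟨ht.1, ht.2.le⟩ e
    exact ⟨(inv_anti₀ hN (le_max_left _ _)).trans this.1, this.2.trans (le_max_left _ _)⟩
  · exact (hg t ⟨ht.1, ht.2.le⟩).2.mono_of_mem_nhdsWithin
      (mem_of_superset (Icc_mem_nhdsGE ht.2) (Icc_subset_Icc_left ht.1))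
  · have := hNg t ⟨ht.1, ht.2.le⟩ e
    exact ⟨(inv_anti₀ hN' (le_max_right _ _)).trans this.1, this.2.trans (le_max_right _ _)⟩

lemma phys_exists {m : ℕ} (G : ℝ → (Fin m → ℝ) → Fin m → ℝ)
    (hlip : ∀ δ R : ℝ, 0 < δ → 0 < R → ∃ L : NNReal, ∀ t : ℝ, LipschitzOnWith L (G t)
      {x : Fin m → ℝ | ∀ e, δ ≤ x e ∧ x e ≤ R})
    (hcont : ∀ x, Continuous fun t => G t x) (C : ℝ) (hC : 0 ≤ C)
    (hlow : ∀ t x, (∀ e, 0 < x e) → ∀ e, -(C * x e) ≤ G t x e)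
    (hup : ∀ δ : ℝ, 0 < δ → ∃ D : ℝ, 0 ≤ D ∧ ∀ t x, (∀ e, δ ≤ x e) → ∀ e, G t x e ≤ D)
    (x₀ : Fin m → ℝ) (hx₀ : ∀ e, 0 < x₀ e) (T : ℝ) (hT : 0 < T) :
    ∃ x : ℝ → Fin m → ℝ, x 0 = x₀ ∧
      ∀ t ∈ Icc 0 T, (∀ e, 0 < x t e) ∧ HasDerivWithinAt x (G t (x t)) (Icc 0 T) t := by
  obtain ⟨ε, hε, hεx⟩ : ∃ ε : ℝ, 0 < ε ∧ ∀ e, ε ≤ x₀ e := by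
    have hs : 0 ≤ ∑ e, (x₀ e)⁻¹ := Finset.sum_nonneg fun e _ => by have := hx₀ e; positivity
    refine ⟨(1 + ∑ e, (x₀ e)⁻¹)⁻¹, by positivity, fun e => ?_⟩
    refine inv_le_of_inv_le₀ (hx₀ e) ?_
    have := Finset.single_le_sum (f := fun e => (x₀ e)⁻¹)
        (fun e _ => by have := hx₀ e; positivity) (Finset.mem_univ e)
    linarith
  set δ := ε * Real.exp (-(C + 1) * T) with hδdef
  have hδ : 0 < δ := by positivity
  obtain ⟨D, hD, hDG⟩ := hup δ hδ
  set R := ‖x₀‖ + (D + 1) * T + δ with hRdef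
  have hR : 0 < R := by positivity
  have hδR : δ ≤ R := by
    have : 0 ≤ ‖x₀‖ + (D + 1) * T := by positivity
    linarith
  obtain ⟨L, hL⟩ := hlip δ R hδ hR
  let P : (Fin m → ℝ) → Fin m → ℝ := fun x e => max δ (min R (x e))
  have hPbox : ∀ x, P x ∈ {x : Fin m → ℝ | ∀ e, δ ≤ x e ∧ x e ≤ R} := fun x e =>
    ⟨le_max_left _ _, max_le hδR (min_le_left _ _)⟩
  have hPlip : LipschitzWith 1 P := by
    refine LipschitzWith.of_dist_le_mul fun x y => ?_
    rw [NNReal.coe_one, one_mul, dist_pi_le_iff dist_nonneg]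
    intro e
    refine le_trans ?_ (dist_le_pi_dist x y e)
    simp only [Real.dist_eq, P]
    rw [max_comm δ, max_comm δ, min_comm R, min_comm R]
    exact (abs_max_sub_max_le_abs _ _ _).trans ((abs_min_sub_min_le_max _ _ _ _).trans (by simp))
  have hPid : ∀ x : Fin m → ℝ, (∀ e, δ ≤ x e ∧ x e ≤ R) → P x = x := by
    intro x hx; funext e
    simp only [P]
    rw [min_eq_right (hx e).2, max_eq_right (hx e).1]
  have hPpos : ∀ x e, 0 < P x e := fun x e => hδ.trans_le (hPbox x e).1
  have hup' : ∀ t x e, G t (P x) e ≤ D := fun t x e => hDG t _ (fun e => (hPbox x e).1) e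
  have hlow' : ∀ t x e, -(C * P x e) ≤ G t (P x) e := fun t x e => hlow t _ (hPpos x) e
  have hM : 0 ≤ D + C * R := by positivity
  have hbd : ∀ t x, ‖G t (P x)‖ ≤ D + C * R := by
    intro t x
    refine (pi_norm_le_iff_of_nonneg hM).2 fun e => ?_
    have h1 : C * P x e ≤ C * R := mul_le_mul_of_nonneg_left (hPbox x e).2 hC
    have h2 : 0 ≤ C * R := by positivity
    rw [Real.norm_eq_abs, abs_le]
    constructor <;> linarith [hup' t x e, hlow' t x e]
  have hPL : IsPicardLindelof (fun t x => G t (P x)) (tmin := 0) (tmax := T)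
      ⟨0, le_refl _, hT.le⟩ x₀ (⟨D + C * R, hM⟩ * ⟨T, hT.le⟩) 0 ⟨D + C * R, hM⟩ L := by
    refine ⟨fun t _ => ?_, fun x _ => (hcont (P x)).continuousOn, fun t _ x _ => hbd t x, ?_⟩
    · have := (hL t).comp (hPlip.lipschitzOnWith (s := univ)) fun x _ => hPbox x
      rw [mul_one] at this
      exact this.mono (subset_univ _)
    · simp only [sub_zero, max_eq_left hT.le, NNReal.coe_mul, NNReal.coe_mk, NNReal.coe_zero]
      exact le_refl _
  obtain ⟨x, hx0, hx⟩ := hPL.exists_eq_forall_mem_Icc_hasDerivWithinAt₀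
  replace hx0 : x 0 = x₀ := hx0
  have hxe : ∀ e, ∀ t ∈ Icc 0 T, HasDerivWithinAt (fun s => x s e) (G t (P (x t)) e) (Icc 0 T) t :=
    fun e t ht => hasDerivWithinAt_pi.1 (hx t ht) e
  have hce : ∀ e, ContinuousOn (fun s => x s e) (Icc 0 T) := fun e t ht =>
    (hxe e t ht).continuousWithinAt
  have hxr : ∀ e, ∀ t ∈ Ico 0 T, HasDerivWithinAt (fun s => x s e) (G t (P (x t)) e) (Ici t) t :=
    fun e t ht => (hxe e t ⟨ht.1, ht.2.le⟩).mono_of_mem_nhdsWithin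
      (mem_of_superset (Icc_mem_nhdsGE ht.2) (Icc_subset_Icc_left ht.1))
  have hupper : ∀ e, ∀ t ∈ Icc 0 T, x t e ≤ R := by
    intro e t ht
    have hB : ∀ t, HasDerivAt (fun s => x₀ e + (D + 1) * s) (D + 1) t := fun t => by
      simpa using ((hasDerivAt_id t).const_mul (D + 1)).const_add (x₀ e)
    have := image_le_of_deriv_right_lt_deriv_boundary' (hce e) (hxr e)
      (B := fun s => x₀ e + (D + 1) * s) (B' := fun _ => D + 1) (by simp [hx0])
      (by fun_prop) (fun t _ => (hB t).hasDerivWithinAt)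
      (fun t _ _ => by linarith [hup' t (x t) e]) ht
    have h2 : x₀ e ≤ ‖x₀‖ := (le_abs_self _).trans (norm_le_pi_norm x₀ e)
    have h3 : (D + 1) * t ≤ (D + 1) * T := mul_le_mul_of_nonneg_left ht.2 (by positivity)
    linarith
  have hwδ : ∀ e, ∀ t ∈ Icc 0 T, δ ≤ x₀ e * Real.exp (-(C + 1) * t) := by
    intro e t ht
    have h1 : -(C + 1) * T ≤ -(C + 1) * t := by nlinarith [ht.2]
    have := hεx e
    rw [hδdef]
    gcongr
    exact (hx₀ e).le
  have hlower : ∀ e, ∀ t ∈ Icc 0 T, δ ≤ x t e := by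
    intro e t ht
    have hB : ∀ t, HasDerivAt (fun s => -(x₀ e * Real.exp (-(C + 1) * s)))
        ((C + 1) * (x₀ e * Real.exp (-(C + 1) * t))) t := fun t => by
      have h1 : HasDerivAt (fun s => -(C + 1) * s) (-(C + 1)) t := by
        simpa using (hasDerivAt_id t).const_mul (-(C + 1))
      have := (h1.exp.const_mul (x₀ e)).neg
      exact this.congr_deriv (by ring)
    have := image_le_of_deriv_right_lt_deriv_boundary' (hce e).neg (fun t ht => (hxr e t ht).neg)
      (B := fun s => -(x₀ e * Real.exp (-(C + 1) * s)))
      (B' := fun t => (C + 1) * (x₀ e * Real.exp (-(C + 1) * t))) (by simp [hx0])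
      (by fun_prop) (fun t _ => (hB t).hasDerivWithinAt)
      (fun t ht heq => by
        have ht' : t ∈ Icc 0 T := ⟨ht.1, ht.2.le⟩
        have h1 : x t e = x₀ e * Real.exp (-(C + 1) * t) := by
          simpa using heq
        have h2 : P (x t) e = x t e := by
          simp only [P]
          rw [min_eq_right (hupper e t ht'), max_eq_right]
          rw [h1]; exact hwδ e t ht'
        have h3 := hlow' t (x t) e
        have h4 := hwδ e t ht'
        rw [h2, h1] at h3
        linarith) ht
    have h2 := hwδ e t ht
    simp only [Pi.neg_apply] at this
    linarith
  refine ⟨x, hx0, fun t ht => ⟨fun e => hδ.trans_le (hlower e t ht), ?_⟩⟩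
  have := hx t ht
  rwa [hPid (x t) fun e => ⟨hlower e t ht, hupper e t ht⟩] at this

/-- Existence, uniqueness and positivity of the solution of the
non-uniform Physarum dynamics `ẋ_e = a_e(x,t)(|q_e(x)| − x_e)` for Lipschitz
reactivities with `0 ≤ a_e(x,t) ≤ C` and positive initial value. -/
theorem nonuniform_physarum_existence_uniqueness {n m : ℕ} (hnm : n ≤ m)
    (A : Matrix (Fin n) (Fin m) ℝ) (b : Fin n → ℝ) (c : Fin m → ℝ)
    (hAZ : ∀ i j, ∃ z : ℤ, A i j = (z : ℝ))
    (hbZ : ∀ i, ∃ z : ℤ, b i = (z : ℝ))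
    (hcZ : ∀ e, ∃ z : ℤ, c e = (z : ℝ))
    (hc1 : ∀ e, 1 ≤ c e)
    (hrank : A.rank = n)
    (hfeas : ∃ f : Fin m → ℝ, A.mulVec f = b)
    (q : (Fin m → ℝ) → Fin m → ℝ)
    (hq : ∀ x : Fin m → ℝ, (∀ e, 0 < x e) →
      A.mulVec (q x) = b ∧
      ∀ f : Fin m → ℝ, A.mulVec f = b → energy c x (q x) ≤ energy c x f)
    (a : Fin m → (Fin m → ℝ) → ℝ → ℝ) (K : NNReal) (C : ℝ)
    (haL : ∀ e, LipschitzWith K (fun p : (Fin m → ℝ) × ℝ => a e p.1 p.2))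
    (hab : ∀ e (x : Fin m → ℝ) (t : ℝ), 0 ≤ a e x t ∧ a e x t ≤ C)
    (x₀ : Fin m → ℝ) (hx₀ : ∀ e, 0 < x₀ e) :
    ∃ x : ℝ → Fin m → ℝ,
      (x 0 = x₀ ∧ (∀ t ∈ Set.Ici (0 : ℝ), ∀ e, 0 < x t e) ∧
        ∀ t ∈ Set.Ici (0 : ℝ), ∀ e, HasDerivWithinAt (fun s => x s e)
          (a e (x t) t * (|q (x t) e| - x t e)) (Set.Ici 0) t) ∧
      ∀ y : ℝ → Fin m → ℝ,
        (y 0 = x₀ ∧ (∀ t ∈ Set.Ici (0 : ℝ), ∀ e, 0 < y t e) ∧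
          ∀ t ∈ Set.Ici (0 : ℝ), ∀ e, HasDerivWithinAt (fun s => y s e)
            (a e (y t) t * (|q (y t) e| - y t e)) (Set.Ici 0) t) →
        ∀ t ∈ Set.Ici (0 : ℝ), y t = x t := by
  obtain ⟨f, hf⟩ := hfeas
  have hC : 0 ≤ max C 0 := le_max_right _ _
  have hab' : ∀ e (x : Fin m → ℝ) (t : ℝ), 0 ≤ a e x t ∧ a e x t ≤ max C 0 := fun e x t =>
    ⟨(hab e x t).1, (hab e x t).2.trans (le_max_left _ _)⟩
  set G : ℝ → (Fin m → ℝ) → Fin m → ℝ := fun t x e => a e x t * (|q x e| - x e) with hG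
  have hlip := phys_Glip A b c hc1 f hf q hq a K (max C 0) hC haL hab'
  have hcont : ∀ x, Continuous fun t => G t x := by
    intro x
    refine continuous_pi fun e => ?_
    have : Continuous fun t : ℝ => a e x t := (haL e).continuous.comp (by fun_prop : Continuous fun t : ℝ => (x, t))
    exact this.mul continuous_const
  have hlow : ∀ t x, (∀ e, 0 < x e) → ∀ e, -(max C 0 * x e) ≤ G t x e := by
    intro t x hx e
    have h1 := hab' e x t
    have h2 : 0 ≤ a e x t * |q x e| := mul_nonneg h1.1 (abs_nonneg _)
    have h3 := mul_le_mul_of_nonneg_right h1.2 (hx e).le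
    simp only [hG, mul_sub]
    linarith
  have hup : ∀ δ : ℝ, 0 < δ → ∃ D : ℝ, 0 ≤ D ∧ ∀ t x, (∀ e, δ ≤ x e) → ∀ e, G t x e ≤ D := by
    intro δ hδ
    have hB0 : 0 ≤ ∑ e, c e / δ * f e ^ 2 :=
      Finset.sum_nonneg fun e _ => by have := hc1 e; positivity
    refine ⟨max C 0 * ∑ e, c e / δ * f e ^ 2, by positivity, fun t x hx e => ?_⟩
    have h1 := hab' e x t
    have h2 := phys_qbound hδ hc1 hx hf (hq x fun e => hδ.trans_le (hx e)).2 e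
    calc G t x e ≤ a e x t * ∑ e, c e / δ * f e ^ 2 :=
          mul_le_mul_of_nonneg_left (by linarith) h1.1
      _ ≤ _ := mul_le_mul_of_nonneg_right h1.2 hB0
  have hex : ∀ T : ℝ, ∃ x : ℝ → Fin m → ℝ, 0 < T → x 0 = x₀ ∧
      ∀ t ∈ Icc 0 T, (∀ e, 0 < x t e) ∧ HasDerivWithinAt x (G t (x t)) (Icc 0 T) t := by
    intro T
    by_cases hT : 0 < T
    · obtain ⟨x, hx⟩ := phys_exists G hlip hcont _ hC hlow hup x₀ hx₀ T hT
      exact ⟨x, fun _ => hx⟩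
    · exact ⟨0, fun h => absurd h hT⟩
  choose X hX using hex
  have restr : ∀ T S : ℝ, S ≤ T → 0 < T → ∀ t ∈ Icc 0 S, (∀ e, 0 < X T t e) ∧
      HasDerivWithinAt (X T) (G t (X T t)) (Icc 0 S) t := fun T S h hT t ht => by
    have := (hX T hT).2 t ⟨ht.1, ht.2.trans h⟩
    exact ⟨this.1, this.2.mono (Icc_subset_Icc_right h)⟩
  have agree : ∀ T S : ℝ, 0 < S → S ≤ T → ∀ t ∈ Icc 0 S, X T t = X S t := fun T S hS h =>
    phys_unique G hlip S (X T) (X S) (by rw [(hX T (hS.trans_le h)).1, (hX S hS).1])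
      (restr T S h (hS.trans_le h)) (hX S hS).2
  have agree' : ∀ T t : ℝ, 0 < T → t ∈ Icc 0 T → X (t + 1) t = X T t := by
    intro T t hT ht
    have ht1 : 0 < t + 1 := by linarith [ht.1]
    rcases le_total (t + 1) T with h | h
    · exact (agree T (t + 1) ht1 h t ⟨ht.1, by linarith⟩).symm
    · exact agree (t + 1) T hT h t ht
  refine ⟨fun t => X (t + 1) t, ⟨?_, ?_, ?_⟩, ?_⟩
  · exact (hX (0 + 1) (by norm_num)).1
  · intro t ht
    have ht' : (0 : ℝ) ≤ t := ht
    exact ((hX (t + 1) (by linarith)).2 t ⟨ht', by linarith⟩).1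
  · intro t ht
    have ht' : (0 : ℝ) ≤ t := ht
    have ht1 : 0 < t + 1 := by linarith
    have h1 := ((hX (t + 1) ht1).2 t ⟨ht', by linarith⟩).2
    have h2 : HasDerivWithinAt (fun s => X (s + 1) s) (G t (X (t + 1) t)) (Icc 0 (t + 1)) t :=
      h1.congr (fun s hs => agree' (t + 1) s ht1 hs) rfl
    have h3 : HasDerivWithinAt (fun s => X (s + 1) s) (G t (X (t + 1) t)) (Ici 0) t := by
      refine h2.mono_of_mem_nhdsWithin ?_
      rw [← Ici_inter_Iic]
      exact inter_mem_nhdsWithin _ (Iic_mem_nhds (by linarith))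
    exact hasDerivWithinAt_pi.1 h3
  · rintro y ⟨hy0, hypos, hyd⟩ t ht
    have ht' : (0 : ℝ) ≤ t := ht
    have ht1 : 0 < t + 1 := by linarith
    refine phys_unique G hlip (t + 1) y (X (t + 1)) (by rw [hy0, (hX _ ht1).1])
      (fun s hs => ⟨hypos s hs.1, ?_⟩) (hX _ ht1).2 ⟨ht', by linarith⟩
    exact hasDerivWithinAt_pi.2 fun e => (hyd s hs.1 e).mono Icc_subset_Ici_self
end

section
/- Let a : [m] × ℝ^m × ℝ → ℝ satisfy 0 ≤ a_e(x,t) ≤ C for a constant C and all e, x, t, and let x : [0,∞) → ℝ^m be a solution of the non-uniform Physarum dynamics with x_e(0) > 0 for all e. Then for all e and all t ≥ 0: x_e(0)·e^{−Ct} ≤ x_e(t) ≤ max(x_e(0), D·‖b‖₁); in particular the solution is positive and bounded. -/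
open Matrix Filter Set

theorem physAux_cramer {n m k : ℕ} (A : Matrix (Fin n) (Fin m) ℝ) (b : Fin n → ℝ)
    (hAZ : ∀ i j, ∃ z : ℤ, A i j = (z : ℝ))
    (D : ℝ) (hD : IsGreatest (subdetSet A) D)
    (s : Fin k → Fin m) (hs : Function.Injective s)
    (hli : LinearIndependent ℝ (A.submatrix id s).col)
    (y : Fin k → ℝ) (hy : (A.submatrix id s).mulVec y = b) (j : Fin k) :
    |y j| ≤ D * ∑ i, |b i| := by
  have hrk : (A.submatrix id s).rank = k := by
    rw [← Matrix.rank_transpose]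
    have h1 : LinearIndependent ℝ (A.submatrix id s)ᵀ.row := hli
    simpa using h1.rank_matrix
  rw [Matrix.rank_eq_finrank_span_row] at hrk
  obtain ⟨f, hf1, hf2, hf3⟩ := Submodule.exists_fun_fin_finrank_span_eq ℝ
    (Set.range (A.submatrix id s).row)
  obtain ⟨u, hu1, hu3⟩ : ∃ u : Fin k → (Fin k → ℝ),
      (∀ i, u i ∈ Set.range (A.submatrix id s).row) ∧ LinearIndependent ℝ u := by
    rw [hrk] at f
    exact ⟨_, fun i => hf1 (Fin.cast hrk.symm i),
      hf3.comp _ (Fin.cast_injective hrk.symm)⟩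
  choose r hr using hu1
  have hrinj : Function.Injective r := by
    intro i i' h
    apply hu3.injective
    rw [← hr i, ← hr i', h]
  have hrow : (A.submatrix r s).row = u := by
    funext i
    rw [← hr i]
    rfl
  have hunit : IsUnit (A.submatrix r s) := by
    rw [← Matrix.linearIndependent_rows_iff_isUnit, hrow]
    exact hu3
  have hdet : (A.submatrix r s).det ≠ 0 :=
    ((Matrix.isUnit_iff_isUnit_det _).1 hunit).ne_zero
  have hdet1 : 1 ≤ |(A.submatrix r s).det| := by
    choose Z hZ using hAZ
    have h2 : A.submatrix r s = ((Matrix.of Z).submatrix r s).map (Int.castRingHom ℝ) := by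
      ext i j
      simp [hZ]
    have h3 : (A.submatrix r s).det = ((((Matrix.of Z).submatrix r s).det : ℤ) : ℝ) := by
      rw [h2, ← RingHom.mapMatrix_apply, ← RingHom.map_det]
      rfl
    rw [h3] at hdet ⊢
    have h4 : ((Matrix.of Z).submatrix r s).det ≠ 0 := by exact_mod_cast hdet
    exact_mod_cast Int.one_le_abs h4
  have hMy : (A.submatrix r s).mulVec y = fun i => b (r i) := by
    funext i
    rw [← hy]
    rfl
  have hadj : (A.submatrix r s).det * y j
      = ∑ i, (A.submatrix r s).adjugate j i * b (r i) := by
    have h5 : (A.submatrix r s).adjugate.mulVec ((A.submatrix r s).mulVec y)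
        = (A.submatrix r s).det • y := by
      rw [Matrix.mulVec_mulVec, Matrix.adjugate_mul, Matrix.smul_mulVec, Matrix.one_mulVec]
    rw [hMy] at h5
    have h6 := congrFun h5 j
    simp only [Pi.smul_apply, smul_eq_mul] at h6
    rw [← h6]
    rfl
  have hadjD : ∀ i, |(A.submatrix r s).adjugate j i| ≤ D := by
    intro i
    cases k with
    | zero => exact j.elim0
    | succ k =>
      rw [Matrix.adjugate_fin_succ_eq_det_submatrix, abs_mul, abs_pow, abs_neg, abs_one,
        one_pow, one_mul, Matrix.submatrix_submatrix]
      exact hD.2 ⟨k, _, _, hrinj.comp Fin.succAbove_right_injective,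
        hs.comp Fin.succAbove_right_injective, rfl⟩
  have hD0 : 0 ≤ D := le_trans (abs_nonneg _) (hadjD j)
  calc |y j| ≤ |(A.submatrix r s).det| * |y j| := le_mul_of_one_le_left (abs_nonneg _) hdet1
    _ = |∑ i, (A.submatrix r s).adjugate j i * b (r i)| := by rw [← abs_mul, hadj]
    _ ≤ ∑ i, |(A.submatrix r s).adjugate j i * b (r i)| := Finset.abs_sum_le_sum_abs _ _
    _ ≤ ∑ i, D * |b (r i)| := by
        apply Finset.sum_le_sum
        intro i _
        rw [abs_mul]
        exact mul_le_mul_of_nonneg_right (hadjD i) (abs_nonneg _)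
    _ = D * ∑ i, |b (r i)| := by rw [Finset.mul_sum]
    _ ≤ D * ∑ i, |b i| := by
        apply mul_le_mul_of_nonneg_left _ hD0
        have : ∑ i, |b (r i)| = ∑ i ∈ Finset.univ.map ⟨r, hrinj⟩, |b i| := by simp
        rw [this]
        exact Finset.sum_le_sum_of_subset_of_nonneg (Finset.subset_univ _)
          (fun _ _ _ => abs_nonneg _)

theorem physAux_decomp {n m : ℕ} (A : Matrix (Fin n) (Fin m) ℝ) (b : Fin n → ℝ)
    (hAZ : ∀ i j, ∃ z : ℤ, A i j = (z : ℝ))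
    (D : ℝ) (hD : IsGreatest (subdetSet A) D) (hD0 : 0 ≤ D)
    (q : Fin m → ℝ)
    (hcirc : ∀ g : Fin m → ℝ, A.mulVec g = 0 → (∀ e, 0 ≤ g e * q e) →
      (∀ e, q e = 0 → g e = 0) → g = 0) (e₀ : Fin m) :
    ∀ (N : ℕ) (f : Fin m → ℝ), (Finset.univ.filter (fun e => f e ≠ 0)).card ≤ N →
      A.mulVec f = b → (∀ e, 0 ≤ f e * q e) → (∀ e, q e = 0 → f e = 0) →
      f e₀ * q e₀ ≤ (D * ∑ i, |b i|) * |q e₀| := by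
  intro N
  induction N with
  | zero =>
    intro f hN _ _ _
    have : f e₀ = 0 := by
      by_contra h
      have h1 : e₀ ∈ Finset.univ.filter (fun e => f e ≠ 0) := by simp [h]
      have := Finset.card_pos.2 ⟨_, h1⟩
      omega
    rw [this, zero_mul]
    positivity
  | succ N ih =>
    intro f hN hAf hsgn hz
    by_cases hdep : ∃ g : Fin m → ℝ, A.mulVec g = 0 ∧ g ≠ 0 ∧ ∀ e, f e = 0 → g e = 0
    · obtain ⟨g, hg1, hg2, hg3, hg4⟩ : ∃ g : Fin m → ℝ, A.mulVec g = 0 ∧ g ≠ 0 ∧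
          (∀ e, f e = 0 → g e = 0) ∧ 0 ≤ g e₀ * q e₀ := by
        obtain ⟨g, h1, h2, h3⟩ := hdep
        rcases le_total 0 (g e₀ * q e₀) with h | h
        · exact ⟨g, h1, h2, h3, h⟩
        · refine ⟨-g, by rw [Matrix.mulVec_neg, h1, neg_zero], neg_ne_zero.2 h2, ?_, ?_⟩
          · intro e he
            simp [h3 e he]
          · simp only [Pi.neg_apply]
            linarith
      obtain ⟨e₁, he₁⟩ : ∃ e, g e * q e < 0 := by
        by_contra! hcon
        exact hg2 (hcirc g hg1 hcon (fun e he => hg3 e (hz e he)))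
      obtain ⟨e₂, he₂, hmin⟩ := Finset.exists_min_image
        (Finset.univ.filter (fun e => g e * q e < 0)) (fun e => - f e / g e) ⟨e₁, by simp [he₁]⟩
      simp only [Finset.mem_filter, Finset.mem_univ, true_and] at he₂ hmin
      have hgne : ∀ e, g e * q e < 0 → g e ≠ 0 := by
        intro e he h
        rw [h, zero_mul] at he
        exact lt_irrefl _ he
      set l : ℝ := - f e₂ / g e₂ with hl
      have hkey : ∀ e, g e * q e < 0 → (- f e / g e) * (g e * q e) = - (f e * q e) := by
        intro e he
        have := hgne e he
        field_simp
      have hl0 : 0 ≤ l := by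
        have h1 := hkey e₂ he₂
        have h2 := hsgn e₂
        by_contra! hlt
        nlinarith [mul_pos_of_neg_of_neg hlt he₂]
      have hnew := ih (fun e => f e + l * g e) ?_ ?_ ?_ ?_
      · refine le_trans ?_ hnew
        have := mul_nonneg hl0 hg4
        nlinarith
      · have hlt : (Finset.univ.filter (fun e => f e + l * g e ≠ 0)).card
            < (Finset.univ.filter (fun e => f e ≠ 0)).card := by
          apply Finset.card_lt_card
          rw [Finset.ssubset_iff_of_subset]
          · refine ⟨e₂, ?_, ?_⟩
            · simp only [Finset.mem_filter, Finset.mem_univ, true_and]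
              exact fun h => hgne e₂ he₂ (hg3 e₂ h)
            · simp only [Finset.mem_filter, Finset.mem_univ, true_and, not_not]
              have := hgne e₂ he₂
              rw [hl]
              field_simp
              ring
          · intro e
            simp only [Finset.mem_filter, Finset.mem_univ, true_and]
            intro h h'
            apply h
            rw [h', hg3 e h']
            ring
        omega
      · have : (fun e => f e + l * g e) = f + l • g := by
          funext e
          simp
        rw [this, Matrix.mulVec_add, Matrix.mulVec_smul, hg1, hAf]
        simp
      · intro e
        have h0 := hsgn e
        rcases lt_or_ge (g e * q e) 0 with h | h
        · have h1 := hkey e h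
          have h2 := hmin e h
          have h3 := mul_le_mul_of_nonpos_right h2 h.le
          nlinarith
        · have := mul_nonneg hl0 h
          nlinarith
      · intro e he
        have h1 := hz e he
        rw [h1, hg3 e h1]
        ring
    · push Not at hdep
      by_cases hf0 : f e₀ = 0
      · rw [hf0, zero_mul]
        positivity
      set S := Finset.univ.filter (fun e => f e ≠ 0) with hS
      let s : Fin S.card → Fin m := fun j => S.equivFin.symm j
      have hs : Function.Injective s :=
        Subtype.val_injective.comp S.equivFin.symm.injective
      have hrange : ∀ e, f e ≠ 0 → ∃ j, s j = e := by
        intro e he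
        exact ⟨S.equivFin ⟨e, by simp [hS, he]⟩, by simp [s]⟩
      have hsf : ∀ j, f (s j) ≠ 0 := by
        intro j
        have := (S.equivFin.symm j).2
        exact (Finset.mem_filter.1 this).2
      have hli : LinearIndependent ℝ (A.submatrix id s).col := by
        rw [Fintype.linearIndependent_iff]
        intro g hg j
        have hz' : ∀ e, f e = 0 → Function.extend s g 0 e = 0 := by
          intro e he
          rw [Function.extend_apply']
          · rfl
          · rintro ⟨j, rfl⟩
            exact hsf j he
        by_contra hgj
        obtain ⟨e, he1, he2⟩ := hdep (Function.extend s g 0) (by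
          funext i
          have h1 := congrFun hg i
          simp only [Finset.sum_apply, Pi.smul_apply, smul_eq_mul, Pi.zero_apply] at h1
          rw [Pi.zero_apply, ← h1]
          symm
          apply Fintype.sum_of_injective s hs
          · intro e he
            rw [Function.extend_apply' _ _ _ (by simpa using he)]
            simp
          · intro j
            rw [hs.extend_apply]
            simp [Matrix.col_apply, mul_comm]) (by
          intro h
          apply hgj
          have := congrFun h (s j)
          rwa [hs.extend_apply] at this)
        exact he2 (hz' e he1)
      obtain ⟨j, hj⟩ := hrange e₀ hf0
      have hb := physAux_cramer A b hAZ D hD s hs hli (fun j => f (s j)) (by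
        funext i
        rw [← hAf]
        apply Fintype.sum_of_injective s hs
        · intro e he
          have : f e = 0 := by
            by_contra h
            exact he (hrange e h)
          rw [this, mul_zero]
        · intro j
          rfl) j
      simp only [hj] at hb
      calc f e₀ * q e₀ ≤ |f e₀ * q e₀| := le_abs_self _
        _ = |f e₀| * |q e₀| := abs_mul _ _
        _ ≤ _ := mul_le_mul_of_nonneg_right hb (abs_nonneg _)

theorem physAux_bound {n m : ℕ} (A : Matrix (Fin n) (Fin m) ℝ) (b : Fin n → ℝ) (c : Fin m → ℝ)
    (hAZ : ∀ i j, ∃ z : ℤ, A i j = (z : ℝ)) (hc1 : ∀ e, 1 ≤ c e)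
    (D : ℝ) (hD : IsGreatest (subdetSet A) D)
    (x q : Fin m → ℝ) (hx : ∀ e, 0 < x e) (hq : A.mulVec q = b)
    (hmin : ∀ f : Fin m → ℝ, A.mulVec f = b → energy c x q ≤ energy c x f) (e₀ : Fin m) :
    |q e₀| ≤ D * ∑ i, |b i| := by
  have hD0 : 0 ≤ D := by
    obtain ⟨k, r, s, _, _, h⟩ := hD.1
    rw [h]
    exact abs_nonneg _
  have hw : ∀ e, 0 < c e / x e := fun e => div_pos (by linarith [hc1 e]) (hx e)
  have horth : ∀ g : Fin m → ℝ, A.mulVec g = 0 → ∑ e, c e / x e * (g e * q e) = 0 := by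
    intro g hg
    set L := ∑ e, c e / x e * (g e * q e) with hL
    set G := ∑ e, c e / x e * g e ^ 2 with hG
    have hG0 : 0 ≤ G := Finset.sum_nonneg (fun e _ => mul_nonneg (hw e).le (sq_nonneg _))
    have hquad : ∀ l : ℝ, 0 ≤ 2 * l * L + l ^ 2 * G := by
      intro l
      have h1 := hmin (q + l • g) (by
        rw [Matrix.mulVec_add, Matrix.mulVec_smul, hg, hq]
        simp)
      have h2 : energy c x (q + l • g) = energy c x q + (2 * l * L + l ^ 2 * G) := by
        simp only [energy, hL, hG, Finset.mul_sum, ← Finset.sum_add_distrib]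
        apply Finset.sum_congr rfl
        intro e _
        simp only [Pi.add_apply, Pi.smul_apply, smul_eq_mul]
        ring
      linarith
    have h3 := hquad (-L / (G + 1))
    have h4 : 2 * (-L / (G + 1)) * L + (-L / (G + 1)) ^ 2 * G
        = - (L ^ 2 * (G + 2)) / (G + 1) ^ 2 := by
      field_simp
      ring
    rw [h4] at h3
    by_contra hne
    have h5 : 0 < L ^ 2 * (G + 2) / (G + 1) ^ 2 := by positivity
    rw [neg_div] at h3
    linarith
  have h := physAux_decomp A b hAZ D hD hD0 q (by
    intro g hg hs hz
    have h1 := (Finset.sum_eq_zero_iff_of_nonneg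
      (fun e _ => mul_nonneg (hw e).le (hs e))).1 (horth g hg)
    funext e
    have h2 := h1 e (Finset.mem_univ e)
    rcases mul_eq_zero.1 h2 with h3 | h3
    · exact absurd h3 (hw e).ne'
    · rcases mul_eq_zero.1 h3 with h4 | h4
      · exact h4
      · exact hz e h4) e₀ _ q le_rfl hq (fun e => mul_self_nonneg _) (fun _ h => h)
  rcases eq_or_ne (q e₀) 0 with h0 | h0
  · rw [h0, abs_zero]
    positivity
  · rw [← abs_mul_abs_self] at h
    exact le_of_mul_le_mul_right h (abs_pos.2 h0)

theorem physAux_lower (C : ℝ) (y α p : ℝ → ℝ) (hy0 : 0 < y 0)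
    (hα : ∀ t, 0 ≤ α t ∧ α t ≤ C) (hp : ∀ t, 0 ≤ p t)
    (hd : ∀ t ∈ Set.Ici (0 : ℝ), HasDerivWithinAt y (α t * (p t - y t)) (Set.Ici 0) t) :
    ∀ t ∈ Set.Ici (0 : ℝ), y 0 * Real.exp (-C * t) ≤ y t := by
  have hcont : ContinuousOn y (Set.Ici 0) := fun t ht => (hd t ht).continuousWithinAt
  have hstep : ∀ T, 0 ≤ T → (∀ t ∈ Set.Ico 0 T, 0 < y t) →
      y 0 * Real.exp (-C * T) ≤ y T := by
    intro T hT hpos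
    have hmono : MonotoneOn (fun t => y t * Real.exp (C * t)) (Set.Icc 0 T) := by
      apply monotoneOn_of_hasDerivWithinAt_nonneg (convex_Icc 0 T)
        (f' := fun t => α t * (p t - y t) * Real.exp (C * t)
          + y t * (Real.exp (C * t) * (C * 1)))
      · apply ContinuousOn.mul (hcont.mono Set.Icc_subset_Ici_self)
        fun_prop
      · intro t ht
        rw [interior_Icc] at ht ⊢
        have h1 : HasDerivWithinAt y (α t * (p t - y t)) (Set.Ioo 0 T) t :=
          (hd t ht.1.le).mono (fun u hu => hu.1.le)
        exact h1.mul (((hasDerivAt_id t).const_mul C).exp.hasDerivWithinAt)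
      · intro t ht
        rw [interior_Icc] at ht
        have h1 := hpos t ⟨ht.1.le, ht.2⟩
        have h2 : 0 ≤ α t * p t + (C - α t) * y t :=
          add_nonneg (mul_nonneg (hα t).1 (hp t))
            (mul_nonneg (by linarith [(hα t).2]) h1.le)
        have h3 := mul_nonneg h2 (Real.exp_pos (C * t)).le
        nlinarith
    have h := hmono (Set.left_mem_Icc.2 hT) (Set.right_mem_Icc.2 hT) hT
    simp only [mul_zero, Real.exp_zero, mul_one] at h
    have h4 := mul_le_mul_of_nonneg_right h (Real.exp_pos (-C * T)).le
    rw [mul_assoc, ← Real.exp_add] at h4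
    have : C * T + -C * T = 0 := by ring
    rwa [this, Real.exp_zero, mul_one] at h4
  have hpos : ∀ t ∈ Set.Ici (0 : ℝ), 0 < y t := by
    by_contra! hcon
    obtain ⟨t, ht, hyt⟩ := hcon
    have ht : 0 ≤ t := ht
    set Z := Set.Icc 0 t ∩ y ⁻¹' Set.Iic 0 with hZ
    have hZc : IsClosed Z :=
      (hcont.mono Set.Icc_subset_Ici_self).preimage_isClosed_of_isClosed isClosed_Icc isClosed_Iic
    have hZne : Z.Nonempty := ⟨t, ⟨ht, le_rfl⟩, hyt⟩
    have hZb : BddBelow Z := ⟨0, fun u hu => hu.1.1⟩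
    have hmem := hZc.csInf_mem hZne hZb
    have h1 := hstep (sInf Z) hmem.1.1 (by
      intro u hu
      by_contra! h
      have : u ∈ Z := ⟨⟨hu.1, hu.2.le.trans hmem.1.2⟩, h⟩
      exact absurd (csInf_le hZb this) (not_le.2 hu.2))
    have h2 : y (sInf Z) ≤ 0 := hmem.2
    have := mul_pos hy0 (Real.exp_pos (-C * sInf Z))
    linarith
  intro t ht
  exact hstep t ht (fun u hu => hpos u hu.1)

theorem physAux_upper (K : ℝ) (y α p : ℝ → ℝ)
    (hα : ∀ t, 0 ≤ α t) (hp : ∀ t ∈ Set.Ici (0 : ℝ), p t ≤ K)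
    (hd : ∀ t ∈ Set.Ici (0 : ℝ), HasDerivWithinAt y (α t * (p t - y t)) (Set.Ici 0) t) :
    ∀ t ∈ Set.Ici (0 : ℝ), y t ≤ max (y 0) K := by
  have hcont : ContinuousOn y (Set.Ici 0) := fun t ht => (hd t ht).continuousWithinAt
  intro t ht
  have ht : 0 ≤ t := ht
  by_contra! hcon
  set M := max (y 0) K with hM
  set Z := Set.Icc 0 t ∩ y ⁻¹' Set.Iic M with hZ
  have hZc : IsClosed Z :=
    (hcont.mono Set.Icc_subset_Ici_self).preimage_isClosed_of_isClosed isClosed_Icc isClosed_Iic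
  have hZne : Z.Nonempty := ⟨0, ⟨le_rfl, ht⟩, show y 0 ≤ M from le_max_left _ _⟩
  have hZb : BddAbove Z := ⟨t, fun u hu => hu.1.2⟩
  have hmem := hZc.csSup_mem hZne hZb
  set s := sSup Z with hs
  have hbig : ∀ u ∈ Set.Ioo s t, M < y u := by
    intro u hu
    by_contra! h
    have : u ∈ Z := ⟨⟨hmem.1.1.trans hu.1.le, hu.2.le⟩, h⟩
    exact absurd (le_csSup hZb this) (not_le.2 hu.1)
  have hanti : AntitoneOn y (Set.Icc s t) := by
    apply antitoneOn_of_hasDerivWithinAt_nonpos (convex_Icc s t)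
      (f' := fun u => α u * (p u - y u))
    · exact hcont.mono (fun u hu => hmem.1.1.trans hu.1)
    · intro u hu
      rw [interior_Icc] at hu ⊢
      exact (hd u (hmem.1.1.trans hu.1.le)).mono (fun v hv => hmem.1.1.trans hv.1.le)
    · intro u hu
      rw [interior_Icc] at hu
      have h1 := hbig u hu
      have h2 := hp u (hmem.1.1.trans hu.1.le)
      have h3 : K ≤ M := le_max_right _ _
      exact mul_nonpos_of_nonneg_of_nonpos (hα u) (by linarith)
  have h1 := hanti (Set.left_mem_Icc.2 hmem.1.2) (Set.right_mem_Icc.2 hmem.1.2) hmem.1.2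
  have h2 : y s ≤ M := hmem.2
  linarith

/-- Any solution of the non-uniform Physarum dynamics with
`0 ≤ a_e(x,t) ≤ C` and positive start satisfies
`x_e(0)e^{−Ct} ≤ x_e(t) ≤ max(x_e(0), D‖b‖₁)`; in particular it is positive and
bounded. -/
theorem nonuniform_physarum_bounds {n m : ℕ} (hnm : n ≤ m)
    (A : Matrix (Fin n) (Fin m) ℝ) (b : Fin n → ℝ) (c : Fin m → ℝ)
    (hAZ : ∀ i j, ∃ z : ℤ, A i j = (z : ℝ))
    (hbZ : ∀ i, ∃ z : ℤ, b i = (z : ℝ))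
    (hcZ : ∀ e, ∃ z : ℤ, c e = (z : ℝ))
    (hc1 : ∀ e, 1 ≤ c e)
    (hrank : A.rank = n)
    (hfeas : ∃ f : Fin m → ℝ, A.mulVec f = b)
    (D : ℝ) (hD : IsGreatest (subdetSet A) D)
    (q : (Fin m → ℝ) → Fin m → ℝ)
    (hq : ∀ x : Fin m → ℝ, (∀ e, 0 < x e) →
      A.mulVec (q x) = b ∧
      ∀ f : Fin m → ℝ, A.mulVec f = b → energy c x (q x) ≤ energy c x f)
    (a : Fin m → (Fin m → ℝ) → ℝ → ℝ) (C : ℝ)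
    (hab : ∀ e (y : Fin m → ℝ) (t : ℝ), 0 ≤ a e y t ∧ a e y t ≤ C)
    (x : ℝ → Fin m → ℝ) (hx₀ : ∀ e, 0 < x 0 e)
    (hdyn : ∀ t ∈ Set.Ici (0 : ℝ), ∀ e, HasDerivWithinAt (fun s => x s e)
      (a e (x t) t * (|q (x t) e| - x t e)) (Set.Ici 0) t) :
    ∀ e, ∀ t ∈ Set.Ici (0 : ℝ),
      x 0 e * Real.exp (-C * t) ≤ x t e ∧
      x t e ≤ max (x 0 e) (D * ∑ i, |b i|) := by
  have hlow : ∀ e, ∀ t ∈ Set.Ici (0 : ℝ), x 0 e * Real.exp (-C * t) ≤ x t e := fun e =>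
    physAux_lower C (fun t => x t e) (fun t => a e (x t) t) (fun t => |q (x t) e|) (hx₀ e)
      (fun t => hab e _ _) (fun t => abs_nonneg _) (fun t ht => hdyn t ht e)
  have hpos : ∀ t ∈ Set.Ici (0 : ℝ), ∀ e, 0 < x t e := fun t ht e =>
    lt_of_lt_of_le (mul_pos (hx₀ e) (Real.exp_pos _)) (hlow e t ht)
  intro e t ht
  refine ⟨hlow e t ht, ?_⟩
  exact physAux_upper (D * ∑ i, |b i|) (fun t => x t e) (fun t => a e (x t) t)
    (fun t => |q (x t) e|) (fun t => (hab e _ _).1)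
    (fun t ht => physAux_bound A b c hAZ hc1 D hD (x t) (q (x t)) (hpos t ht)
      (hq _ (hpos t ht)).1 (hq _ (hpos t ht)).2 e)
    (fun t ht => hdyn t ht e) t ht
end

section
/- Let a : [m] × ℝ^m × ℝ → ℝ be Lipschitz-continuous with 0 ≤ a_e(x,t) ≤ C for all e, x, t, and let x : [0,∞) → ℝ^m be a solution of the non-uniform Physarum dynamics with x_e(t) > 0 for all e and t. Then the function L(t) = E_{x(t)}(q(x(t))) + cᵀx(t) = ∑_e (c_e/x_e(t)) q_e(x(t))² + ∑_e c_e x_e(t) is nonincreasing in t; moreover, its derivative at time t is 0 if and only if for every e, either a_e(x(t),t) = 0 or |q_e(x(t))| = x_e(t). -/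
open Matrix Filter Set

lemma aux_squeeze (l f u : ℝ → ℝ) (S : Set ℝ) (t D : ℝ)
    (hl : HasDerivWithinAt l D S t) (hu : HasDerivWithinAt u D S t)
    (h1 : ∀ s ∈ S, l s ≤ f s) (h2 : ∀ s ∈ S, f s ≤ u s)
    (e1 : l t = f t) (e2 : u t = f t) : HasDerivWithinAt f D S t := by
  rw [hasDerivWithinAt_iff_isLittleO] at *
  refine Asymptotics.IsBigO.trans_isLittleO ?_ (hl.norm_left.add hu.norm_left)
  refine Asymptotics.IsBigO.of_bound 1 ?_
  filter_upwards [self_mem_nhdsWithin] with s hs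
  have a1 := h1 s hs
  have a2 := h2 s hs
  simp only [Real.norm_eq_abs, one_mul, e1, e2, smul_eq_mul]
  rw [abs_of_nonneg (a := |l s - f t - (s - t) * D| + |u s - f t - (s - t) * D|) (by positivity)]
  have b1 := neg_abs_le (l s - f t - (s - t) * D)
  have b2 := le_abs_self (u s - f t - (s - t) * D)
  have b3 := abs_nonneg (l s - f t - (s - t) * D)
  have b4 := abs_nonneg (u s - f t - (s - t) * D)
  rw [abs_le]
  constructor <;> linarith

lemma aux_orth {n m : ℕ} (A : Matrix (Fin n) (Fin m) ℝ) (b : Fin n → ℝ) (c x q0 : Fin m → ℝ)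
    (h0 : A.mulVec q0 = b)
    (hmin : ∀ f : Fin m → ℝ, A.mulVec f = b → energy c x q0 ≤ energy c x f)
    (f : Fin m → ℝ) (hf : A.mulVec f = b) :
    ∑ e, c e / x e * q0 e * f e = energy c x q0 := by
  have key : ∀ r : ℝ, 0 ≤ (energy c x (f - q0)) * (r * r) +
      (2 * ∑ e, c e / x e * q0 e * (f e - q0 e)) * r + 0 := by
    intro r
    have h := hmin (q0 + r • (f - q0)) (by
      rw [Matrix.mulVec_add, Matrix.mulVec_smul, Matrix.mulVec_sub, hf, h0]; simp)
    have : energy c x (q0 + r • (f - q0)) = energy c x q0 + ((energy c x (f - q0)) * (r * r) +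
      (2 * ∑ e, c e / x e * q0 e * (f e - q0 e)) * r + 0) := by
      unfold energy
      simp only [Finset.mul_sum, Finset.sum_mul, add_zero, ← Finset.sum_add_distrib]
      refine Finset.sum_congr rfl fun e _ => ?_
      simp only [Pi.add_apply, Pi.smul_apply, Pi.sub_apply, smul_eq_mul]
      ring
    linarith
  have hd := discrim_le_zero key
  unfold discrim at hd
  have hz : ∑ e, c e / x e * q0 e * (f e - q0 e) = 0 := by
    have : (∑ e, c e / x e * q0 e * (f e - q0 e)) ^ 2 ≤ 0 := by linarith
    exact pow_eq_zero_iff (two_ne_zero) |>.1 (le_antisymm this (sq_nonneg _))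
  have : ∑ e, c e / x e * q0 e * (f e - q0 e) =
      ∑ e, c e / x e * q0 e * f e - energy c x q0 := by
    unfold energy
    rw [← Finset.sum_sub_distrib]
    refine Finset.sum_congr rfl fun e _ => ?_
    ring
  linarith

lemma aux_lower {n m : ℕ} (A : Matrix (Fin n) (Fin m) ℝ) (b : Fin n → ℝ) (c x y q0 : Fin m → ℝ)
    (hc : ∀ e, 0 < c e) (hx : ∀ e, 0 < x e) (hy : ∀ e, 0 < y e)
    (h0 : A.mulVec q0 = b)
    (hmin : ∀ f : Fin m → ℝ, A.mulVec f = b → energy c x q0 ≤ energy c x f)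
    (f : Fin m → ℝ) (hf : A.mulVec f = b) :
    2 * energy c x q0 - ∑ e, c e * q0 e ^ 2 / x e ^ 2 * y e ≤ energy c y f := by
  rw [← aux_orth A b c x q0 h0 hmin f hf]
  unfold energy
  rw [Finset.mul_sum, ← Finset.sum_sub_distrib]
  refine Finset.sum_le_sum fun e _ => ?_
  have h1 := (hx e).ne'
  have h2 := (hy e).ne'
  have : c e / y e * f e ^ 2 - (2 * (c e / x e * q0 e * f e) - c e * q0 e ^ 2 / x e ^ 2 * y e)
      = c e / y e * (f e - y e * q0 e / x e) ^ 2 := by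
    field_simp
    ring
  have h3 : 0 ≤ c e / y e * (f e - y e * q0 e / x e) ^ 2 := by
    have := hc e
    have := hy e
    positivity
  linarith

/-- `L(t) = E_{x(t)}(q(x(t))) + cᵀx(t)` is a Lyapunov function for the
non-uniform Physarum dynamics: it is nonincreasing, and its derivative vanishes at
time `t` iff for every `e`, `a_e(x(t),t) = 0` or `|q_e(x(t))| = x_e(t)`. -/
theorem nonuniform_physarum_lyapunov {n m : ℕ} (hnm : n ≤ m)
    (A : Matrix (Fin n) (Fin m) ℝ) (b : Fin n → ℝ) (c : Fin m → ℝ)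
    (hAZ : ∀ i j, ∃ z : ℤ, A i j = (z : ℝ))
    (hbZ : ∀ i, ∃ z : ℤ, b i = (z : ℝ))
    (hcZ : ∀ e, ∃ z : ℤ, c e = (z : ℝ))
    (hc1 : ∀ e, 1 ≤ c e)
    (hrank : A.rank = n)
    (hfeas : ∃ f : Fin m → ℝ, A.mulVec f = b)
    (q : (Fin m → ℝ) → Fin m → ℝ)
    (hq : ∀ x : Fin m → ℝ, (∀ e, 0 < x e) →
      A.mulVec (q x) = b ∧
      ∀ f : Fin m → ℝ, A.mulVec f = b → energy c x (q x) ≤ energy c x f)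
    (a : Fin m → (Fin m → ℝ) → ℝ → ℝ) (K : NNReal) (C : ℝ)
    (haL : ∀ e, LipschitzWith K (fun p : (Fin m → ℝ) × ℝ => a e p.1 p.2))
    (hab : ∀ e (y : Fin m → ℝ) (t : ℝ), 0 ≤ a e y t ∧ a e y t ≤ C)
    (x : ℝ → Fin m → ℝ)
    (hpos : ∀ t ∈ Set.Ici (0 : ℝ), ∀ e, 0 < x t e)
    (hdyn : ∀ t ∈ Set.Ici (0 : ℝ), ∀ e, HasDerivWithinAt (fun s => x s e)
      (a e (x t) t * (|q (x t) e| - x t e)) (Set.Ici 0) t) :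
    AntitoneOn (fun t => energy c (x t) (q (x t)) + ∑ e, c e * x t e)
      (Set.Ici (0 : ℝ)) ∧
    ∀ t ∈ Set.Ici (0 : ℝ), ∃ L' : ℝ,
      HasDerivWithinAt (fun s => energy c (x s) (q (x s)) + ∑ e, c e * x s e)
        L' (Set.Ici 0) t ∧ L' ≤ 0 ∧
      (L' = 0 ↔ ∀ e, a e (x t) t = 0 ∨ |q (x t) e| = x t e) := by
  have hc : ∀ e, 0 < c e := fun e => lt_of_lt_of_le one_pos (hc1 e)
  have main : ∀ t ∈ Set.Ici (0 : ℝ),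
      HasDerivWithinAt (fun s => energy c (x s) (q (x s)) + ∑ e, c e * x s e)
        (-∑ e, a e (x t) t * (c e * (|q (x t) e| + x t e) / x t e ^ 2 *
          (|q (x t) e| - x t e) ^ 2)) (Set.Ici 0) t := by
    intro t ht
    have hxt := hpos t ht
    obtain ⟨h0, hmin⟩ := hq (x t) hxt
    set q0 := q (x t) with hq0
    have hE : HasDerivWithinAt (fun s => energy c (x s) (q (x s)))
        (-∑ e, c e * q0 e ^ 2 / x t e ^ 2 * (a e (x t) t * (|q0 e| - x t e)))
        (Set.Ici 0) t := by
      refine aux_squeeze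
        (fun s => 2 * energy c (x t) q0 - ∑ e, c e * q0 e ^ 2 / x t e ^ 2 * x s e) _
        (fun s => energy c (x s) q0) _ _ _ ?_ ?_ ?_ ?_ ?_ rfl
      · refine HasDerivWithinAt.const_sub _ ?_
        exact HasDerivWithinAt.fun_sum fun e _ => (hdyn t ht e).const_mul _
      · unfold energy
        rw [← Finset.sum_neg_distrib]
        refine HasDerivWithinAt.fun_sum fun e _ => ?_
        have h1 := (((hdyn t ht e).fun_inv (hxt e).ne').const_mul (c e)).mul_const (q0 e ^ 2)
        simp only [← div_eq_mul_inv] at h1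
        refine h1.congr_deriv ?_
        ring
      · intro s hs
        exact aux_lower A b c (x t) (x s) q0 hc hxt (hpos s hs) h0 hmin _ (hq _ (hpos s hs)).1
      · intro s hs
        exact (hq _ (hpos s hs)).2 _ h0
      · have : ∑ e, c e * q0 e ^ 2 / x t e ^ 2 * x t e = energy c (x t) q0 := by
          unfold energy
          refine Finset.sum_congr rfl fun e _ => ?_
          have := (hxt e).ne'
          field_simp
        simp only [this, ← hq0]
        ring
    have hS : HasDerivWithinAt (fun s => ∑ e, c e * x s e)
        (∑ e, c e * (a e (x t) t * (|q0 e| - x t e))) (Set.Ici 0) t :=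
      HasDerivWithinAt.fun_sum fun e _ => (hdyn t ht e).const_mul _
    refine (hE.add hS).congr_deriv ?_
    rw [← Finset.sum_neg_distrib, ← Finset.sum_add_distrib, ← Finset.sum_neg_distrib]
    refine Finset.sum_congr rfl fun e _ => ?_
    have := (hxt e).ne'
    rw [← sq_abs (q0 e)]
    field_simp
    ring
  have hterm : ∀ t ∈ Set.Ici (0 : ℝ), ∀ e, 0 < c e * (|q (x t) e| + x t e) / x t e ^ 2 := by
    intro t ht e
    have := hc e
    have := hpos t ht e
    positivity
  have hnn : ∀ t ∈ Set.Ici (0 : ℝ), ∀ e, 0 ≤ a e (x t) t *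
      (c e * (|q (x t) e| + x t e) / x t e ^ 2 * (|q (x t) e| - x t e) ^ 2) := fun t ht e =>
    mul_nonneg (hab e _ _).1 (mul_nonneg (hterm t ht e).le (sq_nonneg _))
  have hle : ∀ t ∈ Set.Ici (0 : ℝ), (-∑ e, a e (x t) t *
      (c e * (|q (x t) e| + x t e) / x t e ^ 2 * (|q (x t) e| - x t e) ^ 2)) ≤ 0 := fun t ht =>
    neg_nonpos.2 (Finset.sum_nonneg fun e _ => hnn t ht e)
  refine ⟨?_, fun t ht => ⟨_, main t ht, hle t ht, ?_⟩⟩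
  · refine antitoneOn_of_hasDerivWithinAt_nonpos (convex_Ici 0)
      (fun t ht => (main t ht).continuousWithinAt)
      (fun t ht => (main t (interior_subset ht)).mono interior_subset)
      (fun t ht => hle t (interior_subset ht))
  · rw [neg_eq_zero, Finset.sum_eq_zero_iff_of_nonneg fun e _ => hnn t ht e]
    refine ⟨fun h e => ?_, fun h e _ => ?_⟩
    · rcases mul_eq_zero.1 (h e (Finset.mem_univ e)) with h1 | h1
      · exact Or.inl h1
      · rcases mul_eq_zero.1 h1 with h2 | h2
        · exact absurd h2 (hterm t ht e).ne'
        · exact Or.inr (sub_eq_zero.1 (pow_eq_zero_iff two_ne_zero |>.1 h2))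
    · rcases h e with h1 | h1 <;> simp [h1]
end

section
/- Assume that any two distinct basic feasible solutions of Af = b have distinct cost. Let a : [m] × ℝ^m × ℝ → ℝ be Lipschitz-continuous with ε ≤ a_e(x,t) ≤ C for constants 0 < ε ≤ C and all e, x, t, and let x : [0,∞) → ℝ^m be the solution of the non-uniform Physarum dynamics with x(0) > 0. Then there is a basic feasible solution f of Af = b such that, as t → ∞, x(t) → |f|, |q(x(t))| → |f|, and both E_{x(t)}(q(x(t))) and cᵀx(t) converge to cᵀ|f|. -/
open Matrix Filter Set

theorem ph_mulVec_inj {n m : ℕ} (A : Matrix (Fin n) (Fin m) ℝ) (B : Fin n → Fin m)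
    (hB : Function.Injective B) (f : Fin m → ℝ) (h0 : ∀ e, (∀ i, B i ≠ e) → f e = 0) :
    A.mulVec f = (A.submatrix id B).mulVec (fun i => f (B i)) := by
  ext i
  simp only [Matrix.mulVec, dotProduct, Matrix.submatrix_apply, id]
  symm
  rw [← Finset.sum_image (s := Finset.univ) (g := B) (f := fun e => A i e * f e) (hB.injOn)]
  apply Finset.sum_subset (Finset.subset_univ _)
  intro e _ he
  rw [h0 e, mul_zero]
  intro j hj
  exact he (Finset.mem_image.2 ⟨j, Finset.mem_univ _, hj⟩)

theorem ph_bfs_unique {n m : ℕ} (A : Matrix (Fin n) (Fin m) ℝ) (b : Fin n → ℝ)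
    (f g : Fin m → ℝ) (hf : IsBFS A b f) (hg : A.mulVec g = b)
    (h0 : ∀ e, f e = 0 → g e = 0) : g = f := by
  obtain ⟨-, B, hB, hdet, hfB, hf0⟩ := hf
  have hg0 : ∀ e, (∀ i, B i ≠ e) → g e = 0 := fun e he => h0 e (hf0 e he)
  have h1 := ph_mulVec_inj A B hB g hg0
  rw [hg] at h1
  have h2 : (A.submatrix id B)⁻¹.mulVec b = fun i => g (B i) := by
    rw [h1, Matrix.mulVec_mulVec, Matrix.nonsing_inv_mul _ hdet, Matrix.one_mulVec]
  ext e
  by_cases he : ∀ i, B i ≠ e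
  · rw [hg0 e he, hf0 e he]
  · push Not at he
    obtain ⟨i, rfl⟩ := he
    rw [hfB i, h2]

theorem ph_bfs_of_indep {n m : ℕ} (A : Matrix (Fin n) (Fin m) ℝ) (b : Fin n → ℝ)
    (hrank : A.rank = n) (f : Fin m → ℝ) (hf : A.mulVec f = b)
    (h : ∀ r : Fin m → ℝ, A.mulVec r = 0 → (∀ e, f e = 0 → r e = 0) → r = 0) :
    IsBFS A b f := by
  have hs : LinearIndepOn ℝ A.col {e | f e ≠ 0} := by
    rw [linearIndepOn_iff]
    intro l hl hl0
    have := h (fun e => l e) ?_ ?_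
    · ext e; exact congrFun this e
    · rw [Finsupp.linearCombination_apply, Finsupp.sum_fintype _ _ (by simp)] at hl0
      ext i
      have := congrFun hl0 i
      simpa [Matrix.mulVec, dotProduct, mul_comm] using this
    · intro e he
      by_contra hne
      have : e ∈ {e | f e ≠ 0} := hl (by simpa using hne)
      exact this he
  set T := hs.extend (Set.subset_univ _) with hT
  have hli : LinearIndependent ℝ (fun e : T => A.col e) := hs.linearIndepOn_extend (Set.subset_univ _)
  have hspan : Submodule.span ℝ (Set.range (fun e : T => A.col e)) = ⊤ := by
    have h1 := hs.span_image_extend_eq_span_image (Set.subset_univ _)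
    rw [Set.image_univ] at h1
    have h2 : Set.range (fun e : T => A.col e) = A.col '' T := by
      ext; simp
    rw [h2, h1]
    apply Submodule.eq_top_of_finrank_eq
    rw [← Matrix.rank_eq_finrank_span_cols, hrank]
    simp
  have hfin : Fintype T := Fintype.ofFinite T
  have hcard : Fintype.card T = n := by
    have := finrank_span_eq_card hli
    rw [hspan, finrank_top] at this
    simpa using this.symm
  let eq : Fin n ≃ T := (Fintype.equivFinOfCardEq hcard).symm
  let B : Fin n → Fin m := fun i => (eq i : Fin m)
  have hB : Function.Injective B := Subtype.val_injective.comp eq.injective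
  have hdet : IsUnit (A.submatrix id B).det := by
    rw [← Matrix.isUnit_iff_isUnit_det, ← Matrix.linearIndependent_cols_iff_isUnit]
    exact hli.comp eq eq.injective
  have hf0 : ∀ e, (∀ i, B i ≠ e) → f e = 0 := by
    intro e he
    by_contra hne
    have : e ∈ T := hs.subset_extend (Set.subset_univ _) hne
    exact he (eq.symm ⟨e, this⟩) (by simp [B])
  refine ⟨hf, B, hB, hdet, ?_, hf0⟩
  intro i
  have h1 := ph_mulVec_inj A B hB f hf0
  rw [← hf, h1, Matrix.mulVec_mulVec, Matrix.nonsing_inv_mul _ hdet, Matrix.one_mulVec]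

theorem ph_move {m : ℕ} (f r : Fin m → ℝ) (h0 : ∀ e, f e = 0 → r e = 0)
    (hneg : ∃ e, r e * f e < 0) :
    ∃ s : ℝ, 0 < s ∧ SignCompat (f + s • r) f ∧ ∃ e, f e ≠ 0 ∧ (f + s • r) e = 0 := by
  classical
  obtain ⟨e1, he1⟩ := hneg
  obtain ⟨e, he, hmin⟩ := Finset.exists_min_image
    (Finset.univ.filter fun e => r e * f e < 0) (fun e => - f e / r e) ⟨e1, by simpa using he1⟩
  have he : r e * f e < 0 := by simpa using he
  have hr0 : r e ≠ 0 := by rintro h; simp [h] at he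
  have hf0 : f e ≠ 0 := by rintro h; simp [h] at he
  have hs : 0 < -f e / r e := by
    have : -f e / r e = -(r e * f e) / (r e)^2 := by field_simp
    rw [this]
    have : 0 < (r e)^2 := by positivity
    apply div_pos <;> linarith
  refine ⟨-f e / r e, hs, ?_, e, hf0, ?_⟩
  · intro e' hne
    set s := -f e / r e
    have hfe' : f e' ≠ 0 := by
      intro h
      apply hne
      simp [h, h0 e' h]
    have hge : 0 ≤ (f + s • r) e' * f e' := by
      simp only [Pi.add_apply, Pi.smul_apply, smul_eq_mul]
      rcases lt_or_ge (r e' * f e') 0 with hlt | hge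
      · have h1 : s ≤ -f e' / r e' := hmin e' (by simpa using hlt)
        have hr' : r e' ≠ 0 := by rintro h; simp [h] at hlt
        have h2 : (-f e' / r e') * (r e' * f e') ≤ s * (r e' * f e') :=
          mul_le_mul_of_nonpos_right h1 hlt.le
        have h3 : (-f e' / r e') * (r e' * f e') = - (f e')^2 := by field_simp
        nlinarith
      · have : 0 ≤ s * (r e' * f e') := mul_nonneg hs.le hge
        nlinarith [sq_nonneg (f e')]
    exact lt_of_le_of_ne hge (mul_ne_zero hne hfe').symm
  · simp only [Pi.add_apply, Pi.smul_apply, smul_eq_mul]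
    field_simp
    ring

theorem ph_sign_eq {u v : ℝ} (h : 0 < u * v) : u / |u| = v / |v| := by
  rcases pos_and_pos_or_neg_and_neg_of_mul_pos h with ⟨h1, h2⟩ | ⟨h1, h2⟩
  · rw [abs_of_pos h1, abs_of_pos h2, div_self h1.ne', div_self h2.ne']
  · rw [abs_of_neg h1, abs_of_neg h2, div_neg, div_neg, div_self h1.ne, div_self h2.ne]

theorem ph_abs_eq {u : ℝ} : |u| = u * (u / |u|) := by
  by_cases h : u = 0
  · simp [h]
  · have : |u| ≠ 0 := by simpa using h
    field_simp
    exact sq_abs u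

def PhP {n m : ℕ} (A : Matrix (Fin n) (Fin m) ℝ) (c f : Fin m → ℝ) : Prop :=
  ∀ r : Fin m → ℝ, A.mulVec r = 0 → (∀ e, f e = 0 → r e = 0) →
    ∑ e, c e * (r e * (f e / |f e|)) = 0

theorem ph_sc_zero {m : ℕ} {f' f : Fin m → ℝ} (h : SignCompat f' f) :
    ∀ e, f e = 0 → f' e = 0 := by
  intro e he
  by_contra hne
  have := h e hne
  simp [he] at this

theorem ph_P_mono {n m : ℕ} (A : Matrix (Fin n) (Fin m) ℝ) (c f f' : Fin m → ℝ)
    (hP : PhP A c f) (h : SignCompat f' f) : PhP A c f' := by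
  intro r hr hr0
  rw [← hP r hr (fun e he => hr0 e (ph_sc_zero h e he))]
  apply Finset.sum_congr rfl
  intro e _
  by_cases he : f' e = 0
  · simp [hr0 e he]
  · rw [ph_sign_eq (h e he)]

theorem ph_cost_eq {n m : ℕ} (A : Matrix (Fin n) (Fin m) ℝ) (c f r : Fin m → ℝ) (s : ℝ)
    (hP : PhP A c f) (hr : A.mulVec r = 0) (hr0 : ∀ e, f e = 0 → r e = 0)
    (h : SignCompat (f + s • r) f) : costVec c (f + s • r) = costVec c f := by
  have h1 : costVec c (f + s • r) = ∑ e, c e * ((f + s • r) e * (f e / |f e|)) := by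
    apply Finset.sum_congr rfl
    intro e _
    by_cases he : (f + s • r) e = 0
    · rw [he]; simp
    · rw [ph_abs_eq, ph_sign_eq (h e he)]
  have h2 : costVec c f = ∑ e, c e * (f e * (f e / |f e|)) := by
    apply Finset.sum_congr rfl
    intro e _
    rw [← ph_abs_eq]
  have h3 := hP r hr hr0
  rw [h1, h2, ← add_zero (∑ e, c e * (f e * (f e / |f e|))), ← mul_zero s, ← h3, Finset.mul_sum,
    ← Finset.sum_add_distrib]
  apply Finset.sum_congr rfl
  intro e _
  simp only [Pi.add_apply, Pi.smul_apply, smul_eq_mul]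
  ring

theorem ph_bfs_of_P {n m : ℕ} (A : Matrix (Fin n) (Fin m) ℝ) (b : Fin n → ℝ) (c : Fin m → ℝ)
    (hc1 : ∀ e, 1 ≤ c e) (hrank : A.rank = n)
    (hdistinct : ∀ f g : Fin m → ℝ, IsBFS A b f → IsBFS A b g → f ≠ g →
      costVec c f ≠ costVec c g) (N : ℕ) :
    ∀ (f : Fin m → ℝ), (Finset.univ.filter fun e => f e ≠ 0).card ≤ N → A.mulVec f = b →
      PhP A c f → IsBFS A b f := by
  induction N with
  | zero =>
    intro f hN hf hP
    apply ph_bfs_of_indep A b hrank f hf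
    intro r _ hr0
    have hN : (Finset.univ.filter fun e => f e ≠ 0) = ∅ := by
      simpa using hN
    ext e
    apply hr0
    by_contra he
    have : e ∈ (Finset.univ.filter fun e => f e ≠ 0) := by simpa using he
    rw [hN] at this
    simp at this
  | succ N ih =>
    intro f hN hf hP
    apply ph_bfs_of_indep A b hrank f hf
    intro r hr hr0
    by_contra hne
    have key : ∀ r : Fin m → ℝ, A.mulVec r = 0 → (∀ e, f e = 0 → r e = 0) → r ≠ 0 →
        ∃ s : ℝ, 0 < s ∧ IsBFS A b (f + s • r) ∧ costVec c (f + s • r) = costVec c f := by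
      intro r hr hr0 hne
      have hex : ∃ e, r e * f e < 0 := by
        have hsum := hP r hr hr0
        obtain ⟨e0, he0⟩ : ∃ e, r e ≠ 0 := by
          by_contra hcon
          push Not at hcon
          exact hne (funext hcon)
        have hfe0 : f e0 ≠ 0 := fun h => he0 (hr0 e0 h)
        by_contra hcon
        push Not at hcon
        have hterm : ∀ e ∈ Finset.univ, 0 ≤ c e * (r e * (f e / |f e|)) := by
          intro e _
          have h1 : 0 ≤ c e := zero_le_one.trans (hc1 e)
          have h2 : r e * (f e / |f e|) = r e * f e / |f e| := by ring
          rw [h2]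
          exact mul_nonneg h1 (div_nonneg (hcon e) (abs_nonneg _))
        rw [Finset.sum_eq_zero_iff_of_nonneg hterm] at hsum
        have := hsum e0 (Finset.mem_univ _)
        have hc0 : c e0 ≠ 0 := (lt_of_lt_of_le zero_lt_one (hc1 e0)).ne'
        simp [hc0, he0, hfe0] at this
      obtain ⟨s, hs, hsc, e, hfe, he⟩ := ph_move f r hr0 hex
      refine ⟨s, hs, ?_, ph_cost_eq A c f r s hP hr hr0 hsc⟩
      apply ih
      · have : (Finset.univ.filter fun e => (f + s • r) e ≠ 0).card
            < (Finset.univ.filter fun e => f e ≠ 0).card := by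
          apply Finset.card_lt_card
          rw [Finset.ssubset_iff_of_subset]
          · refine ⟨e, by simpa using hfe, ?_⟩
            rw [Finset.mem_filter]
            rintro ⟨-, h⟩
            exact h he
          · intro e'
            simp only [Finset.mem_filter, Finset.mem_univ, true_and]
            intro h1 h2
            exact h1 (ph_sc_zero hsc e' h2)
        omega
      · rw [Matrix.mulVec_add, Matrix.mulVec_smul, hr, hf]; simp
      · exact ph_P_mono A c f _ hP hsc
    obtain ⟨s, hs, hb1, hc1'⟩ := key r hr hr0 hne
    obtain ⟨s', hs', hb2, hc2'⟩ := key (-r) (by rw [Matrix.mulVec_neg, hr, neg_zero])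
      (fun e he => by simp [hr0 e he]) (by simpa using hne)
    refine hdistinct _ _ hb1 hb2 ?_ (hc1'.trans hc2'.symm)
    intro h
    apply hne
    have h3 : (s + s') • r = 0 := by
      have := congrArg (fun g => g - f + s' • r) h
      simp only [add_sub_cancel_left] at this
      rw [add_smul, this]; simp
    rcases smul_eq_zero.1 h3 with h | h
    · linarith
    · exact h

noncomputable def phD {m : ℕ} (c x g : Fin m → ℝ) : ℝ :=
  ∑ e, c e * ((|g e| - x e) ^ 2 / x e)

noncomputable def phL {m : ℕ} (c x g : Fin m → ℝ) : ℝ :=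
  energy c x g + ∑ e, c e * x e

theorem ph_energy_id {m : ℕ} (c x g : Fin m → ℝ) (hx : ∀ e, 0 < x e) :
    energy c x g = phD c x g + ∑ e, (2 * c e * |g e| - c e * x e) := by
  unfold energy phD
  rw [← Finset.sum_add_distrib]
  apply Finset.sum_congr rfl
  intro e _
  have := (hx e).ne'
  field_simp
  rw [← sq_abs (g e)]
  ring

theorem ph_opt {n m : ℕ} (A : Matrix (Fin n) (Fin m) ℝ) (b : Fin n → ℝ) (c x g : Fin m → ℝ)
    (hg : A.mulVec g = b)
    (hmin : ∀ f : Fin m → ℝ, A.mulVec f = b → energy c x g ≤ energy c x f)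
    (r : Fin m → ℝ) (hr : A.mulVec r = 0) :
    ∑ e, c e * (r e * (g e / x e)) = 0 := by
  set S := ∑ e, c e * (r e * (g e / x e)) with hS
  have h1 : ∀ s : ℝ, 0 ≤ s * (2 * S) + s ^ 2 * energy c x r := by
    intro s
    have h2 := hmin (g + s • r) (by rw [Matrix.mulVec_add, Matrix.mulVec_smul, hr, hg]; simp)
    have h3 : energy c x (g + s • r) = energy c x g + (s * (2 * S) + s ^ 2 * energy c x r) := by
      simp only [energy, hS, Finset.mul_sum]
      rw [← Finset.sum_add_distrib, ← Finset.sum_add_distrib]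
      apply Finset.sum_congr rfl
      intro e _
      simp only [Pi.add_apply, Pi.smul_apply, smul_eq_mul]
      ring
    linarith
  set R := energy c x r
  by_contra hne
  have hS2 : 0 < S ^ 2 := by positivity
  have h4 := h1 (-S / (|R| + 1))
  have hp : 0 < |R| + 1 := by positivity
  have h5 : -S / (|R| + 1) * (2 * S) + (-S / (|R| + 1)) ^ 2 * R
      = S ^ 2 * (R - 2 * (|R| + 1)) / (|R| + 1) ^ 2 := by
    field_simp
    ring
  rw [h5] at h4
  have h6 : R - 2 * (|R| + 1) < 0 := by linarith [le_abs_self R, abs_nonneg R]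
  have : S ^ 2 * (R - 2 * (|R| + 1)) / (|R| + 1) ^ 2 < 0 :=
    div_neg_of_neg_of_pos (mul_neg_of_pos_of_neg hS2 h6) (by positivity)
  linarith

theorem ph_limit {n m : ℕ} (A : Matrix (Fin n) (Fin m) ℝ) (b : Fin n → ℝ) (c : Fin m → ℝ)
    (hc1 : ∀ e, 1 ≤ c e) (hrank : A.rank = n)
    (hdistinct : ∀ f g : Fin m → ℝ, IsBFS A b f → IsBFS A b g → f ≠ g →
      costVec c f ≠ costVec c g)
    (y g : ℕ → Fin m → ℝ) (hy : ∀ k e, 0 < y k e) (hg : ∀ k, A.mulVec (g k) = b)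
    (hmin : ∀ k, ∀ f : Fin m → ℝ, A.mulVec f = b → energy c (y k) (g k) ≤ energy c (y k) f)
    (y' g' : Fin m → ℝ) (hyl : Tendsto y atTop (nhds y')) (hgl : Tendsto g atTop (nhds g'))
    (hD : Tendsto (fun k => phD c (y k) (g k)) atTop (nhds 0)) :
    IsBFS A b g' ∧ y' = (fun e => |g' e|) ∧
      Tendsto (fun k => phL c (y k) (g k)) atTop (nhds (2 * costVec c g')) := by
  have hye : ∀ e, Tendsto (fun k => y k e) atTop (nhds (y' e)) := fun e => tendsto_pi_nhds.1 hyl e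
  have hge : ∀ e, Tendsto (fun k => g k e) atTop (nhds (g' e)) := fun e => tendsto_pi_nhds.1 hgl e
  have hAg : A.mulVec g' = b := by
    have h1 : Tendsto (fun k => A.mulVec (g k)) atTop (nhds (A.mulVec g')) :=
      ((Continuous.matrix_mulVec continuous_const continuous_id).tendsto g').comp hgl
    simp only [hg] at h1
    exact tendsto_nhds_unique h1 tendsto_const_nhds |>.symm ▸ rfl
  have hcpos : ∀ e, 0 < c e := fun e => lt_of_lt_of_le zero_lt_one (hc1 e)
  have hyg : y' = fun e => |g' e| := by
    ext e
    have h1 : ∀ k, (|g k e| - y k e) ^ 2 ≤ y k e * phD c (y k) (g k) := by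
      intro k
      have h2 : c e * ((|g k e| - y k e) ^ 2 / y k e) ≤ phD c (y k) (g k) :=
        Finset.single_le_sum (f := fun e => c e * ((|g k e| - y k e) ^ 2 / y k e))
          (fun e _ => mul_nonneg (hcpos e).le (div_nonneg (sq_nonneg _) (hy k e).le))
          (Finset.mem_univ e)
      have h3 : (|g k e| - y k e) ^ 2 / y k e ≤ c e * ((|g k e| - y k e) ^ 2 / y k e) :=
        le_mul_of_one_le_left (div_nonneg (sq_nonneg _) (hy k e).le) (hc1 e)
      have h4 := h3.trans h2
      rw [div_le_iff₀ (hy k e)] at h4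
      linarith
    have h5 : Tendsto (fun k => y k e * phD c (y k) (g k)) atTop (nhds (y' e * 0)) := (hye e).mul hD
    have h6 : Tendsto (fun k => (|g k e| - y k e) ^ 2) atTop (nhds ((|g' e| - y' e) ^ 2)) :=
      (((hge e).abs).sub (hye e)).pow 2
    have h7 := le_of_tendsto_of_tendsto' h6 h5 h1
    have h8 : |g' e| - y' e = 0 := by
      rw [mul_zero] at h7
      exact pow_eq_zero_iff (two_ne_zero) |>.1 (le_antisymm h7 (sq_nonneg _))
    linarith
  refine ⟨?_, hyg, ?_⟩
  · refine ph_bfs_of_P A b c hc1 hrank hdistinct _ g' le_rfl hAg ?_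
    intro r hr hr0
    have h1 : Tendsto (fun k => ∑ e, c e * (r e * (g k e / y k e))) atTop
        (nhds (∑ e, c e * (r e * (g' e / |g' e|)))) := by
      apply tendsto_finsetSum
      intro e _
      by_cases he : g' e = 0
      · simp [hr0 e he]
      · have h2 : y' e = |g' e| := congrFun hyg e
        rw [← h2]
        exact (((hge e).div (hye e) (by rw [h2]; simpa using he)).const_mul _).const_mul _
    have h3 : ∀ k, ∑ e, c e * (r e * (g k e / y k e)) = 0 := fun k =>
      ph_opt A b c (y k) (g k) (hg k) (hmin k) r hr
    simp only [h3] at h1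
    exact (tendsto_nhds_unique h1 tendsto_const_nhds)
  · have h1 : ∀ k, phL c (y k) (g k) = phD c (y k) (g k) + ∑ e, 2 * c e * |g k e| := by
      intro k
      unfold phL
      rw [ph_energy_id _ _ _ (hy k), add_assoc, ← Finset.sum_add_distrib]
      congr 1
      apply Finset.sum_congr rfl
      intro e _
      ring
    simp only [h1]
    have h2 : 2 * costVec c g' = 0 + ∑ e, 2 * c e * |g' e| := by
      rw [costVec, Finset.mul_sum, zero_add]
      apply Finset.sum_congr rfl
      intro e _
      ring
    rw [h2]
    apply hD.add
    apply tendsto_finsetSum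
    intro e _
    exact ((hge e).abs).const_mul _

theorem ph_energy_nonneg {m : ℕ} (c x g : Fin m → ℝ) (hc1 : ∀ e, 1 ≤ c e) (hx : ∀ e, 0 < x e) :
    0 ≤ energy c x g :=
  Finset.sum_nonneg fun e _ => mul_nonneg (div_nonneg (zero_le_one.trans (hc1 e)) (hx e).le)
    (sq_nonneg _)

theorem ph_q_sq {m : ℕ} (c x g : Fin m → ℝ) (hc1 : ∀ e, 1 ≤ c e) (hx : ∀ e, 0 < x e) (e : Fin m) :
    g e ^ 2 ≤ x e * energy c x g := by
  have h1 : c e / x e * g e ^ 2 ≤ energy c x g :=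
    Finset.single_le_sum (f := fun e => c e / x e * g e ^ 2)
      (fun e _ => mul_nonneg (div_nonneg (zero_le_one.trans (hc1 e)) (hx e).le)
    (sq_nonneg _)) (Finset.mem_univ e)
  have h2 : g e ^ 2 ≤ c e * g e ^ 2 := le_mul_of_one_le_left (sq_nonneg _) (hc1 e)
  have h3 : c e / x e * g e ^ 2 = c e * g e ^ 2 / x e := by ring
  rw [h3, div_le_iff₀ (hx e)] at h1
  linarith

theorem ph_x_le {m : ℕ} (c x : Fin m → ℝ) (hc1 : ∀ e, 1 ≤ c e) (hx : ∀ e, 0 < x e) (e : Fin m) :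
    x e ≤ ∑ e, c e * x e := by
  have h1 : c e * x e ≤ ∑ e, c e * x e :=
    Finset.single_le_sum (f := fun e => c e * x e)
      (fun e _ => mul_nonneg (zero_le_one.trans (hc1 e)) (hx e).le) (Finset.mem_univ e)
  have h2 : x e ≤ c e * x e := le_mul_of_one_le_left (hx e).le (hc1 e)
  linarith

/-- continuity of the energy along the trajectory -/
theorem ph_cont {m : ℕ} (c : Fin m → ℝ) (hc1 : ∀ e, 1 ≤ c e)
    (x g : ℝ → Fin m → ℝ)
    (hpos : ∀ t ∈ Set.Ici (0 : ℝ), ∀ e, 0 < x t e)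
    (hmin : ∀ t ∈ Set.Ici (0 : ℝ), ∀ s ∈ Set.Ici (0 : ℝ),
      energy c (x t) (g t) ≤ energy c (x t) (g s))
    (hx : ∀ e, ContinuousOn (fun s => x s e) (Set.Ici 0)) :
    ContinuousOn (fun t => energy c (x t) (g t)) (Set.Ici 0) := by
  intro t ht
  have hxt : ∀ e, Tendsto (fun s => x s e) (nhdsWithin t (Set.Ici 0)) (nhds (x t e)) :=
    fun e => hx e t ht
  have hmem : ∀ᶠ s in nhdsWithin t (Set.Ici 0), s ∈ Set.Ici (0:ℝ) := self_mem_nhdsWithin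
  rw [ContinuousWithinAt, tendsto_order]
  constructor
  · intro u hu
    -- E t ≤ (1+δ) E s
    have hE : 0 ≤ energy c (x t) (g t) := ph_energy_nonneg c _ _ hc1 (hpos t ht)
    rcases lt_or_ge u 0 with hu0 | hu0
    · filter_upwards [hmem] with s hs
      exact lt_of_lt_of_le hu0 (ph_energy_nonneg c _ _ hc1 (hpos s hs))
    obtain ⟨κ, hκ1, hκ⟩ : ∃ κ : ℝ, 1 < κ ∧ κ * u < energy c (x t) (g t) := by
      have h1 : Tendsto (fun κ : ℝ => κ * u) (nhdsWithin 1 (Set.Ioi 1)) (nhds (1 * u)) :=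
        ((continuous_id.mul continuous_const).tendsto 1).mono_left nhdsWithin_le_nhds
      rw [one_mul] at h1
      have h2 := (h1.eventually_lt_const hu).and self_mem_nhdsWithin
      obtain ⟨κ, h3, h4⟩ := h2.exists
      exact ⟨κ, h4, h3⟩
    have hev : ∀ᶠ s in nhdsWithin t (Set.Ici 0), ∀ e, x s e < κ * x t e := by
      rw [eventually_all]
      intro e
      exact (hxt e).eventually_lt_const (by nlinarith [hpos t ht e])
    filter_upwards [hmem, hev] with s hs hse
    have h1 := hmin t ht s hs
    have h2 : energy c (x t) (g s) ≤ κ * energy c (x s) (g s) := by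
      unfold energy
      rw [Finset.mul_sum]
      apply Finset.sum_le_sum
      intro e _
      have hp := hpos s hs e
      have hpt := hpos t ht e
      have : c e / x t e ≤ κ * (c e / x s e) := by
        rw [← mul_div_assoc, div_le_div_iff₀ hpt hp]
        nlinarith [hse e, hc1 e]
      nlinarith [sq_nonneg (g s e), mul_le_mul_of_nonneg_right this (sq_nonneg (g s e))]
    have h3 : κ * u < κ * energy c (x s) (g s) := by linarith
    exact lt_of_mul_lt_mul_left h3 (by linarith)
  · intro u hu
    have h1 : Tendsto (fun s => energy c (x s) (g t)) (nhdsWithin t (Set.Ici 0))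
        (nhds (energy c (x t) (g t))) := by
      apply tendsto_finsetSum
      intro e _
      exact (tendsto_const_nhds.div (hxt e) (hpos t ht e).ne').mul_const _
    filter_upwards [hmem, h1.eventually_lt_const hu] with s hs hlt
    exact lt_of_le_of_lt (hmin s hs t ht) hlt

theorem ph_decay {m : ℕ} (c : Fin m → ℝ) (hc1 : ∀ e, 1 ≤ c e)
    (x g : ℝ → Fin m → ℝ) (α : Fin m → ℝ → ℝ) (ε : ℝ) (hε : 0 < ε) (hα : ∀ e t, ε ≤ α e t)
    (hpos : ∀ t ∈ Set.Ici (0 : ℝ), ∀ e, 0 < x t e)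
    (hmin : ∀ t ∈ Set.Ici (0 : ℝ), ∀ s ∈ Set.Ici (0 : ℝ),
      energy c (x t) (g t) ≤ energy c (x t) (g s))
    (hdyn : ∀ t ∈ Set.Ici (0 : ℝ), ∀ e, HasDerivWithinAt (fun s => x s e)
      (α e t * (|g t e| - x t e)) (Set.Ici 0) t)
    (T τ d : ℝ) (hT : 0 ≤ T) (hτ : 0 ≤ τ)
    (hd : ∀ t ∈ Set.Ico T (T + τ), d ≤ phD c (x t) (g t)) :
    phL c (x (T + τ)) (g (T + τ)) ≤ phL c (x T) (g T) - ε * d * τ := by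
  have hxc : ∀ e, ContinuousOn (fun s => x s e) (Set.Ici 0) :=
    fun e t ht => (hdyn t ht e).continuousWithinAt
  have hLc : ContinuousOn (fun t => phL c (x t) (g t)) (Set.Ici 0) := by
    unfold phL
    apply (ph_cont c hc1 x g hpos hmin hxc).add
    apply continuousOn_finsetSum
    intro e _
    exact continuousOn_const.mul (hxc e)
  have hsub : Set.Icc T (T + τ) ⊆ Set.Ici 0 := fun t ht => hT.trans ht.1
  have key := image_le_of_liminf_slope_right_le_deriv_boundary
    (f := fun t => phL c (x t) (g t)) (a := T) (b := T + τ)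
    (hLc.mono hsub) (B := fun t => phL c (x T) (g T) + (-(ε * d)) * (t - T))
    (B' := fun _ => -(ε * d)) (by simp) (by fun_prop)
    (by
      intro t _
      have : HasDerivAt (fun t => phL c (x T) (g T) + (-(ε * d)) * (t - T)) (-(ε * d) * 1) t :=
        (((hasDerivAt_id t).sub_const T).const_mul _).const_add _
      rw [mul_one] at this
      exact this.hasDerivWithinAt)
    (by
      intro t ht r hr
      have ht0 : t ∈ Set.Ici (0:ℝ) := hT.trans ht.1
      have hder : HasDerivWithinAt (fun s => phL c (x s) (g t))
          (∑ e, (c e * (-(α e t * (|g t e| - x t e)) / x t e ^ 2) * g t e ^ 2)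
            + ∑ e, c e * (α e t * (|g t e| - x t e))) (Set.Ici 0) t := by
        unfold phL energy
        apply HasDerivWithinAt.add
        · apply HasDerivWithinAt.fun_sum
          intro e _
          have h1 := ((((hdyn t ht0 e).fun_inv (hpos t ht0 e).ne').const_mul (c e)).mul_const
            (g t e ^ 2))
          simpa only [div_eq_mul_inv] using h1
        · apply HasDerivWithinAt.fun_sum
          intro e _
          exact (hdyn t ht0 e).const_mul (c e)
      have hle : (∑ e, (c e * (-(α e t * (|g t e| - x t e)) / x t e ^ 2) * g t e ^ 2)
            + ∑ e, c e * (α e t * (|g t e| - x t e))) ≤ -(ε * phD c (x t) (g t)) := by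
        unfold phD
        rw [← Finset.sum_add_distrib, Finset.mul_sum, ← Finset.sum_neg_distrib]
        apply Finset.sum_le_sum
        intro e _
        have hp := hpos t ht0 e
        have ha := hα e t
        have hc := hc1 e
        have hq := abs_nonneg (g t e)
        rw [← sq_abs (g t e)]
        set w := |g t e|
        set u := x t e
        have e1 : c e * (-(α e t * (w - u)) / u ^ 2) * w ^ 2 + c e * (α e t * (w - u))
          = -(α e t * (c e * ((w - u) ^ 2 / u)) * ((w + u) / u)) := by
          field_simp
          ring
        rw [e1]
        have h0 : 0 ≤ c e * ((w - u) ^ 2 / u) := by positivity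
        have h1 : 1 ≤ (w + u) / u := by rw [le_div_iff₀ hp]; linarith
        have h2 : ε * (c e * ((w - u) ^ 2 / u)) ≤ α e t * (c e * ((w - u) ^ 2 / u)) :=
          mul_le_mul_of_nonneg_right ha h0
        have h3 : α e t * (c e * ((w - u) ^ 2 / u)) ≤ α e t * (c e * ((w - u) ^ 2 / u)) * ((w + u) / u) :=
          le_mul_of_one_le_right (mul_nonneg (hε.le.trans ha) h0) h1
        linarith
      have hlt : (∑ e, (c e * (-(α e t * (|g t e| - x t e)) / x t e ^ 2) * g t e ^ 2)
            + ∑ e, c e * (α e t * (|g t e| - x t e))) < r := by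
        have := mul_le_mul_of_nonneg_left (hd t ht) hε.le
        linarith
      have hder' := hder.mono (s := Set.Ioi t) (fun s hs => (ht0.trans (le_of_lt hs) : (0:ℝ) ≤ s))
      have hev := hder'.limsup_slope_le' (by simp) hlt
      have hev2 : ∀ᶠ z in nhdsWithin t (Set.Ioi t), slope (fun t => phL c (x t) (g t)) t z < r := by
        filter_upwards [hev, self_mem_nhdsWithin] with z hz hzt
        refine lt_of_le_of_lt ?_ hz
        have hzt : t < z := hzt
        rw [slope_def_field, slope_def_field]
        apply div_le_div_of_nonneg_right _ (sub_pos.2 hzt).le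
        apply sub_le_sub_right
        unfold phL
        have := hmin z (ht0.trans hzt.le) t ht0
        linarith
      exact hev2.frequently)
  have := key (x := T + τ) ⟨by linarith, le_rfl⟩
  beta_reduce at this
  linarith

/-- Under `ε ≤ a_e(x,t) ≤ C` and distinct costs of basic feasible
solutions, the solution of the non-uniform Physarum dynamics converges to `|f|` for
some basic feasible solution `f`, and so do `|q(x(t))|`, the energy, and the cost. -/
theorem nonuniform_physarum_converges_to_fixed_point {n m : ℕ} (hnm : n ≤ m)
    (A : Matrix (Fin n) (Fin m) ℝ) (b : Fin n → ℝ) (c : Fin m → ℝ)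
    (hAZ : ∀ i j, ∃ z : ℤ, A i j = (z : ℝ))
    (hbZ : ∀ i, ∃ z : ℤ, b i = (z : ℝ))
    (hcZ : ∀ e, ∃ z : ℤ, c e = (z : ℝ))
    (hc1 : ∀ e, 1 ≤ c e)
    (hrank : A.rank = n)
    (hfeas : ∃ f : Fin m → ℝ, A.mulVec f = b)
    (hdistinct : ∀ f g : Fin m → ℝ, IsBFS A b f → IsBFS A b g → f ≠ g →
      costVec c f ≠ costVec c g)
    (q : (Fin m → ℝ) → Fin m → ℝ)
    (hq : ∀ x : Fin m → ℝ, (∀ e, 0 < x e) →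
      A.mulVec (q x) = b ∧
      ∀ f : Fin m → ℝ, A.mulVec f = b → energy c x (q x) ≤ energy c x f)
    (a : Fin m → (Fin m → ℝ) → ℝ → ℝ) (K : NNReal) (ε C : ℝ)
    (hε : 0 < ε) (hεC : ε ≤ C)
    (haL : ∀ e, LipschitzWith K (fun p : (Fin m → ℝ) × ℝ => a e p.1 p.2))
    (hab : ∀ e (y : Fin m → ℝ) (t : ℝ), ε ≤ a e y t ∧ a e y t ≤ C)
    (x : ℝ → Fin m → ℝ) (hx₀ : ∀ e, 0 < x 0 e)
    (hpos : ∀ t ∈ Set.Ici (0 : ℝ), ∀ e, 0 < x t e)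
    (hdyn : ∀ t ∈ Set.Ici (0 : ℝ), ∀ e, HasDerivWithinAt (fun s => x s e)
      (a e (x t) t * (|q (x t) e| - x t e)) (Set.Ici 0) t) :
    ∃ f : Fin m → ℝ, IsBFS A b f ∧
      Tendsto x atTop (nhds (fun e => |f e|)) ∧
      Tendsto (fun t => fun e => |q (x t) e|) atTop (nhds (fun e => |f e|)) ∧
      Tendsto (fun t => energy c (x t) (q (x t))) atTop (nhds (∑ e, c e * |f e|)) ∧
      Tendsto (fun t => ∑ e, c e * x t e) atTop (nhds (∑ e, c e * |f e|)) := by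
  have hc0 : ∀ e, 0 ≤ c e := fun e => zero_le_one.trans (hc1 e)
  have hA : ∀ t ∈ Set.Ici (0 : ℝ), A.mulVec (q (x t)) = b := fun t ht => (hq _ (hpos t ht)).1
  have hmin : ∀ t ∈ Set.Ici (0 : ℝ), ∀ f : Fin m → ℝ, A.mulVec f = b →
      energy c (x t) (q (x t)) ≤ energy c (x t) f := fun t ht => (hq _ (hpos t ht)).2
  have hdecay := ph_decay c hc1 x (fun t => q (x t)) (fun e t => a e (x t) t) ε hε
    (fun e t => (hab e (x t) t).1) hpos (fun t ht s hs => hmin t ht _ (hA s hs)) hdyn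
  set L : ℝ → ℝ := fun t => phL c (x t) (q (x t)) with hL
  set D : ℝ → ℝ := fun t => phD c (x t) (q (x t)) with hDdef
  have hEnn : ∀ t ∈ Set.Ici (0 : ℝ), 0 ≤ energy c (x t) (q (x t)) :=
    fun t ht => ph_energy_nonneg c _ _ hc1 (hpos t ht)
  have hSnn : ∀ t ∈ Set.Ici (0 : ℝ), 0 ≤ ∑ e, c e * x t e :=
    fun t ht => Finset.sum_nonneg fun e _ => mul_nonneg (hc0 e) (hpos t ht e).le
  have hDnn : ∀ t ∈ Set.Ici (0 : ℝ), 0 ≤ D t := fun t ht =>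
    Finset.sum_nonneg fun e _ => mul_nonneg (hc0 e) (div_nonneg (sq_nonneg _) (hpos t ht e).le)
  have hanti : ∀ s t, 0 ≤ s → s ≤ t → L t ≤ L s := by
    intro s t hs hst
    have h1 := hdecay s (t - s) 0 hs (by linarith) (fun u hu => hDnn u (hs.trans hu.1))
    simpa using h1
  have hLnn : ∀ t ∈ Set.Ici (0 : ℝ), 0 ≤ L t := fun t ht => add_nonneg (hEnn t ht) (hSnn t ht)
  obtain ⟨l, hl, hlle⟩ : ∃ l, Tendsto L atTop (nhds l) ∧ ∀ t, 0 ≤ t → l ≤ L t := by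
    have hant : Antitone (fun t => L (max t 0)) := fun s t hst =>
      hanti _ _ (le_max_right _ _) (max_le_max_right 0 hst)
    have hbdd : BddBelow (Set.range fun t => L (max t 0)) :=
      ⟨0, by rintro _ ⟨t, rfl⟩; exact hLnn _ (le_max_right t 0)⟩
    have h1 := tendsto_atTop_ciInf hant hbdd
    refine ⟨_, h1.congr' ?_, ?_⟩
    · filter_upwards [eventually_ge_atTop 0] with t ht
      rw [max_eq_left ht]
    · intro t ht
      have := ciInf_le hbdd t
      simpa only [max_eq_left ht] using this
  set M := L 0 with hM
  have hM0 : 0 ≤ M := hLnn 0 (le_refl (0:ℝ))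
  have hEM : ∀ t ∈ Set.Ici (0 : ℝ), energy c (x t) (q (x t)) ≤ M := fun t ht => by
    have h1 : energy c (x t) (q (x t)) + ∑ e, c e * x t e ≤ M := hanti 0 t le_rfl ht
    linarith [hSnn t ht]
  have hxM : ∀ t ∈ Set.Ici (0 : ℝ), ∀ e, x t e ≤ M := fun t ht e => by
    have h1 : energy c (x t) (q (x t)) + ∑ e, c e * x t e ≤ M := hanti 0 t le_rfl ht
    linarith [hEnn t ht, ph_x_le c (x t) hc1 (hpos t ht) e]
  have hqM : ∀ t ∈ Set.Ici (0 : ℝ), ∀ e, |q (x t) e| ≤ M := fun t ht e => by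
    apply abs_le_of_sq_le_sq _ hM0
    have h1 := ph_q_sq c (x t) (q (x t)) hc1 (hpos t ht) e
    have h2 := mul_le_mul (hxM t ht e) (hEM t ht) (hEnn t ht) hM0
    nlinarith
  have hC0 : 0 ≤ C := hε.le.trans hεC
  have hLip : ∀ s t, 0 ≤ s → 0 ≤ t → dist (x t) (x s) ≤ C * M * |t - s| := by
    intro s t hs ht
    rw [dist_pi_le_iff (by positivity)]
    intro e
    have := Convex.norm_image_sub_le_of_norm_hasDerivWithin_le (C := C * M)
      (fun u hu => hdyn u hu e) (by
        intro u hu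
        rw [Real.norm_eq_abs, abs_mul]
        apply mul_le_mul _ _ (abs_nonneg _) hC0
        · rw [abs_of_nonneg (hε.le.trans (hab e (x u) u).1)]
          exact (hab e (x u) u).2
        · rw [abs_le]
          constructor
          · linarith [hxM u hu e, abs_nonneg (q (x u) e)]
          · linarith [hqM u hu e, hpos u hu e])
      (convex_Ici 0) (show s ∈ Set.Ici (0:ℝ) from hs) (show t ∈ Set.Ici (0:ℝ) from ht)
    simpa only [Real.dist_eq, Real.norm_eq_abs] using this
  -- times with small dissipation
  have hgood : ∀ δ > 0, ∀ τ > 0, ∃ T0, 0 ≤ T0 ∧ ∀ T ≥ T0, ∃ t, T ≤ t ∧ t ≤ T + τ ∧ D t < δ := by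
    intro δ hδ τ hτ
    have h1 : l < l + ε * δ * τ := by
      have : 0 < ε * δ * τ := by positivity
      linarith
    obtain ⟨T0, hT0⟩ := eventually_atTop.1 ((hl.eventually_lt_const h1).and (eventually_ge_atTop 0))
    refine ⟨T0, (hT0 T0 le_rfl).2, ?_⟩
    intro T hT
    by_contra hcon
    push Not at hcon
    have hT' := hT0 T hT
    have h2 := hdecay T τ δ hT'.2 hτ.le (fun t ht => hcon t ht.1 ht.2.le)
    have h3 := hlle (T + τ) (by linarith [hT'.2])
    have h4 := hT'.1
    simp only [hL] at h3 h4
    linarith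
  have hcompact : ∀ ts : ℕ → ℝ, (∀ k, 0 ≤ ts k) → ∃ (φ : ℕ → ℕ) (y' g' : Fin m → ℝ),
      StrictMono φ ∧ Tendsto (fun k => x (ts (φ k))) atTop (nhds y') ∧
      Tendsto (fun k => q (x (ts (φ k)))) atTop (nhds g') := by
    intro ts hts
    have hK : IsCompact ((Set.Icc (fun _ => -M) (fun _ => M) : Set (Fin m → ℝ)) ×ˢ
      (Set.Icc (fun _ => -M) (fun _ => M) : Set (Fin m → ℝ))) := isCompact_Icc.prod isCompact_Icc
    obtain ⟨⟨y', g'⟩, -, φ, hφ, hlim⟩ := hK.tendsto_subseq (x := fun k => (x (ts k), q (x (ts k))))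
      (fun k => ⟨⟨fun e => by
          show -M ≤ x (ts k) e
          linarith [hpos (ts k) (hts k) e], fun e => hxM _ (hts k) e⟩,
        ⟨fun e => (abs_le.1 (hqM _ (hts k) e)).1, fun e => (abs_le.1 (hqM _ (hts k) e)).2⟩⟩)
    refine ⟨φ, y', g', hφ, ?_, ?_⟩
    · exact (continuous_fst.tendsto _).comp hlim
    · exact (continuous_snd.tendsto _).comp hlim
  have hseq : ∀ ts : ℕ → ℝ, (∀ k, 0 ≤ ts k) → Tendsto ts atTop atTop →
      Tendsto (fun k => D (ts k)) atTop (nhds 0) →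
      ∃ (φ : ℕ → ℕ) (g : Fin m → ℝ), StrictMono φ ∧ IsBFS A b g ∧ 2 * costVec c g = l ∧
        Tendsto (fun k => x (ts (φ k))) atTop (nhds (fun e => |g e|)) := by
    intro ts hts htop hD0
    obtain ⟨φ, y', g', hφ, hy, hg⟩ := hcompact ts hts
    obtain ⟨h1, h2, h3⟩ := ph_limit A b c hc1 hrank hdistinct (fun k => x (ts (φ k)))
      (fun k => q (x (ts (φ k)))) (fun k => hpos _ (hts _)) (fun k => hA _ (hts _))
      (fun k => hmin _ (hts _)) y' g' hy hg (hD0.comp hφ.tendsto_atTop)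
    refine ⟨φ, g', hφ, h1, ?_, h2 ▸ hy⟩
    exact tendsto_nhds_unique h3 (hl.comp (htop.comp hφ.tendsto_atTop))
  have hpk : ∀ k : ℕ, (0:ℝ) < 1 / ((k:ℝ) + 1) := fun k => Nat.one_div_pos_of_nat
  choose T0 hT0n hT0 using fun k : ℕ => hgood (1 / ((k:ℝ) + 1)) (hpk k) (1 / ((k:ℝ) + 1)) (hpk k)
  -- main selection
  have hsel : ∀ ns : ℕ → ℝ, Tendsto ns atTop atTop → ∃ (ms : ℕ → ℕ) (g : Fin m → ℝ),
      IsBFS A b g ∧ 2 * costVec c g = l ∧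
        Tendsto (fun k => x (ns (ms k))) atTop (nhds (fun e => |g e|)) := by
    intro ns hns
    have h1 : ∀ j : ℕ, ∃ k, max (T0 j) j ≤ ns k := fun j =>
      (hns.eventually_ge_atTop (max (T0 j) j)).exists
    choose k hk using h1
    have hk0 : ∀ j, 0 ≤ ns (k j) := fun j => (hT0n j).trans ((le_max_left _ _).trans (hk j))
    choose t ht1 ht2 ht3 using fun j => hT0 j (ns (k j)) ((le_max_left _ _).trans (hk j))
    have ht0 : ∀ j, 0 ≤ t j := fun j => (hk0 j).trans (ht1 j)
    have httop : Tendsto t atTop atTop :=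
      tendsto_atTop_mono (fun j => ((le_max_right _ _).trans (hk j)).trans (ht1 j))
        tendsto_natCast_atTop_atTop
    have hDt : Tendsto (fun j => D (t j)) atTop (nhds 0) :=
      squeeze_zero (fun j => hDnn _ (ht0 j)) (fun j => (ht3 j).le)
        tendsto_one_div_add_atTop_nhds_zero_nat
    obtain ⟨φ, g, hφ, hb, hlg, hx⟩ := hseq t ht0 httop hDt
    refine ⟨k ∘ φ, g, hb, hlg, ?_⟩
    refine hx.congr_dist ?_
    have hb0 : Tendsto (fun j : ℕ => C * M * (1 / ((j:ℝ) + 1))) atTop (nhds 0) := by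
      simpa using tendsto_one_div_add_atTop_nhds_zero_nat.const_mul (C * M)
    refine squeeze_zero (fun j => dist_nonneg) (fun j => ?_) (hb0.comp hφ.tendsto_atTop)
    refine (hLip _ _ (hk0 _) (ht0 _)).trans ?_
    apply mul_le_mul_of_nonneg_left _ (by positivity)
    rw [abs_of_nonneg (sub_nonneg.2 (ht1 _))]
    linarith [ht2 (φ j)]
  obtain ⟨-, f, hf, hfl, -⟩ := hsel (fun k => (k:ℝ)) tendsto_natCast_atTop_atTop
  have hxlim : Tendsto x atTop (nhds (fun e => |f e|)) := by
    apply tendsto_of_subseq_tendsto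
    intro ns hns
    obtain ⟨ms, g, hg, hgl, hlim⟩ := hsel ns hns
    have : g = f := by
      by_contra hne
      exact hdistinct g f hg hf hne (by linarith)
    exact ⟨ms, this ▸ hlim⟩
  have hcx : Tendsto (fun t => ∑ e, c e * x t e) atTop (nhds (∑ e, c e * |f e|)) := by
    apply tendsto_finsetSum
    intro e _
    exact (tendsto_pi_nhds.1 hxlim e).const_mul _
  have hE : Tendsto (fun t => energy c (x t) (q (x t))) atTop (nhds (∑ e, c e * |f e|)) := by
    have h1 := hl.sub hcx
    have h2 : l - ∑ e, c e * |f e| = ∑ e, c e * |f e| := by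
      have : 2 * ∑ e, c e * |f e| = l := hfl
      linarith
    rw [h2] at h1
    refine h1.congr ?_
    intro t
    simp only [hL, phL]
    ring
  have hqlim : Tendsto (fun t => q (x t)) atTop (nhds f) := by
    apply tendsto_of_subseq_tendsto
    intro ns hns
    obtain ⟨k0, hk0⟩ := eventually_atTop.1 (hns.eventually_ge_atTop 0)
    obtain ⟨φ, y', g', hφ, hy, hg⟩ := hcompact (fun k => ns (k + k0)) (fun k => hk0 _ (by omega))
    refine ⟨fun k => φ k + k0, ?_⟩
    have hns' : Tendsto (fun k => ns (φ k + k0)) atTop atTop :=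
      hns.comp (tendsto_atTop_mono (fun k => Nat.le_add_right _ _) hφ.tendsto_atTop)
    have h0 : ∀ k, 0 ≤ ns (φ k + k0) := fun k => hk0 _ (by omega)
    have hgf : g' = f := by
      apply ph_bfs_unique A b f g' hf
      · have h1 : Tendsto (fun k => A.mulVec (q (x (ns (φ k + k0))))) atTop (nhds (A.mulVec g')) :=
          ((Continuous.matrix_mulVec continuous_const continuous_id).tendsto g').comp hg
        have h2 : ∀ k, A.mulVec (q (x (ns (φ k + k0)))) = b := fun k => hA _ (h0 k)
        simp only [h2] at h1
        exact tendsto_nhds_unique h1 tendsto_const_nhds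
      · intro e he
        have h1 : Tendsto (fun k => q (x (ns (φ k + k0))) e ^ 2) atTop (nhds (g' e ^ 2)) :=
          (tendsto_pi_nhds.1 hg e).pow 2
        have h2 : Tendsto (fun k => x (ns (φ k + k0)) e * M) atTop (nhds (|f e| * M)) :=
          ((tendsto_pi_nhds.1 hxlim e).comp hns').mul_const M
        have h3 := le_of_tendsto_of_tendsto' h1 h2 (fun k =>
          (ph_q_sq c _ _ hc1 (hpos _ (h0 k)) e).trans
            (mul_le_mul_of_nonneg_left (hEM _ (h0 k)) (hpos _ (h0 k) e).le))
        rw [he, abs_zero, zero_mul] at h3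
        exact pow_eq_zero_iff (two_ne_zero) |>.1 (le_antisymm h3 (sq_nonneg _))
    rw [← hgf]
    exact hg
  refine ⟨f, hf, hxlim, ?_, hE, hcx⟩
  rw [tendsto_pi_nhds]
  intro e
  exact (tendsto_pi_nhds.1 hqlim e).abs
end
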